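/- arXiv:1010.5719 — 4 statements merged into one kernel-verified Lean document; each statement's English description precedes it below -/
import Mathlib

section
/- For every integer n ≥ 2, let τ_n be the permutation of {1,…,n} defined by τ_n(i) = n+1−i. Then the reduced Rauzy class R(τ_n) is finite and has cardinality 2^(n−1) − 1. -/
/-!
Reduced permutations on `d` letters are encoded as `Equiv.Perm (Fin d)`, where the
letter `i ∈ {1,…,d}` corresponds to the index `i - 1 : Fin d`.  The reduced Rauzy moves
are encoded as binary relations (they relate `π` to the result of the move, and are
empty when the move is undefined, i.e. when `π(d) = d`).
-/

/-- The reduced top Rauzy move `𝓡_t`, as a relation: `redStepT π π'` holds iff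
`π(d) ≠ d` and `π'` is the image of `π` under the top move.  Here `last` is the index
corresponding to the letter `d`. -/
def redStepT {d : ℕ} (π π' : Equiv.Perm (Fin d)) : Prop :=
  ∀ last : Fin d, (last : ℕ) + 1 = d →
    (π last : ℕ) + 1 ≠ d ∧
    ∀ i : Fin d, (π' i : ℕ) =
      if (π i : ℕ) ≤ (π last : ℕ) then (π i : ℕ)
      else if (π i : ℕ) + 1 = d then (π last : ℕ) + 1
      else (π i : ℕ) + 1

/-- The reduced bottom Rauzy move `𝓡_b`, as a relation. -/
def redStepB {d : ℕ} (π π' : Equiv.Perm (Fin d)) : Prop :=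
  ∀ last : Fin d, (last : ℕ) + 1 = d →
    (π last : ℕ) + 1 ≠ d ∧
    ∀ j : Fin d,
      ((j : ℕ) ≤ (π.symm last : ℕ) → π' j = π j) ∧
      ((j : ℕ) = (π.symm last : ℕ) + 1 → π' j = π last) ∧
      ((π.symm last : ℕ) + 1 < (j : ℕ) →
        ∀ i : Fin d, (i : ℕ) + 1 = (j : ℕ) → π' j = π i)

/-- The reduced Rauzy class of `π`: the smallest set of permutations containing `π` and
stable under the two reduced Rauzy moves. -/
def redRauzyClass {d : ℕ} (π : Equiv.Perm (Fin d)) : Set (Equiv.Perm (Fin d)) :=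
  {σ | Relation.ReflTransGen (fun a b => redStepT a b ∨ redStepB a b) π σ}

namespace ReducedRauzy

open Equiv

variable {d : ℕ}

/-- The map on `{0, …, d}` that fixes `{0, …, p}` and rotates `{p + 1, …, d}` cyclically. -/
def rotateAboveFun (p v : Fin (d + 1)) : Fin (d + 1) :=
  if h : (v : ℕ) ≤ p then v
  else if h' : (v : ℕ) = d then ⟨p + 1, by omega⟩
  else ⟨v + 1, by omega⟩

theorem rotateAboveFun_val (p v : Fin (d + 1)) :
    (rotateAboveFun p v : ℕ) =
      if (v : ℕ) ≤ p then (v : ℕ) else if (v : ℕ) = d then (p : ℕ) + 1 else (v : ℕ) + 1 := by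
  unfold rotateAboveFun
  split_ifs <;> rfl

theorem rotateAboveFun_injective (p : Fin (d + 1)) : Function.Injective (rotateAboveFun p) := by
  intro v w h
  have h' := congrArg Fin.val h
  rw [rotateAboveFun_val, rotateAboveFun_val] at h'
  apply Fin.ext
  split_ifs at h' <;> omega

/-- `rotateAboveFun` as a permutation. -/
noncomputable def rotateAbove (p : Fin (d + 1)) : Perm (Fin (d + 1)) :=
  Equiv.ofBijective (rotateAboveFun p)
    (Finite.injective_iff_bijective.1 (rotateAboveFun_injective p))

/-- The top move as a total function; it is the identity when `σ` fixes the last letter. -/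
noncomputable def topMove (σ : Perm (Fin (d + 1))) : Perm (Fin (d + 1)) :=
  rotateAbove (σ (Fin.last d)) * σ

theorem topMove_val (σ : Perm (Fin (d + 1))) (i : Fin (d + 1)) :
    (topMove σ i : ℕ) =
      if (σ i : ℕ) ≤ σ (Fin.last d) then (σ i : ℕ)
      else if (σ i : ℕ) = d then (σ (Fin.last d) : ℕ) + 1 else (σ i : ℕ) + 1 :=
  rotateAboveFun_val _ _

theorem topMove_last (σ : Perm (Fin (d + 1))) : topMove σ (Fin.last d) = σ (Fin.last d) := by
  apply Fin.ext
  simp [topMove_val]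

theorem topMove_injective : Function.Injective (topMove (d := d)) := by
  intro σ ρ h
  have hl : σ (Fin.last d) = ρ (Fin.last d) := by
    rw [← topMove_last σ, ← topMove_last ρ, h]
  unfold topMove at h
  rw [hl] at h
  exact mul_left_cancel h

theorem iterate_topMove_val (σ : Perm (Fin (d + 1))) (m : ℕ)
    (hm : m + (σ (Fin.last d) : ℕ) ≤ d) (i : Fin (d + 1)) :
    ((topMove^[m] σ) i : ℕ) =
      if (σ i : ℕ) ≤ σ (Fin.last d) then (σ i : ℕ)
      else if (σ i : ℕ) + m ≤ d then (σ i : ℕ) + m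
      else (σ i : ℕ) + m - (d - σ (Fin.last d)) := by
  induction m generalizing i with
  | zero => have := (σ i).is_le; split_ifs <;> simp_all
  | succ m ih =>
    have ih' := ih (by omega)
    have hl : ((topMove^[m] σ) (Fin.last d) : ℕ) = σ (Fin.last d) := by simp [ih']
    have := (σ i).is_le
    rw [Function.iterate_succ_apply', topMove_val, hl, ih' i]
    split_ifs <;> omega

/-- The cycle of the top move through `σ` has length dividing `d - σ(d)`. -/
theorem iterate_topMove_eq_self (σ : Perm (Fin (d + 1))) :
    topMove^[d - (σ (Fin.last d) : ℕ)] σ = σ := by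
  ext i
  have := (σ i).is_le
  have := (σ (Fin.last d)).is_le
  rw [iterate_topMove_val σ _ (by omega)]
  split_ifs <;> omega

theorem redStepT_iff (σ ρ : Perm (Fin (d + 1))) :
    redStepT σ ρ ↔ (σ (Fin.last d) : ℕ) ≠ d ∧ ρ = topMove σ := by
  constructor
  · intro h
    obtain ⟨h₁, h₂⟩ := h (Fin.last d) (by simp)
    refine ⟨by omega, ?_⟩
    ext i
    rw [h₂, topMove_val]
    simp only [Nat.add_right_cancel_iff]
  · rintro ⟨h₁, rfl⟩ last hlast
    obtain rfl : last = Fin.last d := Fin.ext (by simpa using hlast)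
    refine ⟨by omega, fun i => ?_⟩
    rw [topMove_val]
    simp only [Nat.add_right_cancel_iff]

theorem apply_last_eq_iff_inv (σ : Perm (Fin (d + 1))) :
    (σ (Fin.last d) : ℕ) = d ↔ ((σ⁻¹) (Fin.last d) : ℕ) = d := by
  have key : ∀ ρ : Perm (Fin (d + 1)), (ρ (Fin.last d) : ℕ) = d ↔ ρ (Fin.last d) = Fin.last d :=
    fun ρ => by rw [Fin.ext_iff, Fin.val_last]
  rw [key, key, Perm.inv_eq_iff_eq, eq_comm]

theorem inv_apply_apply_self (σ : Perm (Fin (d + 1))) (i : Fin (d + 1)) : σ⁻¹ (σ i) = i :=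
  σ.symm_apply_apply i

/-- The bottom move is the top move on inverse permutations. -/
theorem redStepB_iff (σ ρ : Perm (Fin (d + 1))) :
    redStepB σ ρ ↔ ((σ⁻¹) (Fin.last d) : ℕ) ≠ d ∧ ρ = (topMove σ⁻¹)⁻¹ := by
  have hk : ((σ⁻¹) (Fin.last d) : ℕ) = (σ.symm (Fin.last d) : ℕ) := rfl
  constructor
  · intro h
    obtain ⟨h₁, h₂⟩ := h (Fin.last d) (by simp)
    have hne : (σ (Fin.last d) : ℕ) ≠ d := by omega
    refine ⟨(apply_last_eq_iff_inv σ).not.1 hne, ?_⟩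
    rw [eq_inv_iff_mul_eq_one]
    ext v
    obtain ⟨i, rfl⟩ := σ.surjective v
    obtain ⟨h₃, h₄, h₅⟩ := h₂ (topMove σ⁻¹ (σ i))
    have hv := topMove_val σ⁻¹ (σ i)
    rw [inv_apply_apply_self] at hv
    rw [Perm.mul_apply, Perm.one_apply]
    split_ifs at hv with c₁ c₂
    · rw [h₃ (by omega), Fin.ext hv]
    · rw [h₄ (by omega), show i = Fin.last d from Fin.ext c₂]
    · rw [h₅ (by omega) i hv.symm]
  · rintro ⟨h₁, rfl⟩ last hlast
    obtain rfl : last = Fin.last d := Fin.ext (by simpa using hlast)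
    have hne := (apply_last_eq_iff_inv σ).not.2 h₁
    refine ⟨by omega, fun j => ⟨fun hj => ?_, fun hj => ?_, fun hj i hi => ?_⟩⟩ <;>
      rw [Perm.inv_eq_iff_eq] <;> apply Fin.ext <;> rw [topMove_val, inv_apply_apply_self]
    · rw [if_pos (by omega)]
    · have := j.is_le
      rw [if_neg (by simp; omega), if_pos (by simp)]
      omega
    · have := j.is_le
      rw [if_neg (by omega), if_neg (by omega)]
      omega

/-- The permutation itself, or its inverse, according to the type of a move. -/
def view (x : Bool) (σ : Perm (Fin (d + 1))) : Perm (Fin (d + 1)) := if x then σ else σ⁻¹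

@[simp] theorem view_view (x : Bool) (σ : Perm (Fin (d + 1))) : view x (view x σ) = σ := by
  cases x <;> simp [view]

theorem view_not (x : Bool) (σ : Perm (Fin (d + 1))) : view (!x) σ = (view x σ)⁻¹ := by
  cases x <;> simp [view]

/-- The top move (`true`) or the bottom move (`false`). -/
noncomputable def step (x : Bool) (σ : Perm (Fin (d + 1))) : Perm (Fin (d + 1)) :=
  view x (topMove (view x σ))

theorem view_step (x : Bool) (σ : Perm (Fin (d + 1))) :
    view x (step x σ) = topMove (view x σ) := by
  simp [step]

theorem step_injective (x : Bool) : Function.Injective (step (d := d) x) := by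
  have hv : Function.Injective (view (d := d) x) :=
    Function.LeftInverse.injective (g := view x) (view_view x)
  exact hv.comp (topMove_injective.comp hv)

theorem view_iterate_step (x : Bool) (σ : Perm (Fin (d + 1))) (m : ℕ) :
    view x ((step x)^[m] σ) = topMove^[m] (view x σ) := by
  induction m with
  | zero => rfl
  | succ m ih => rw [Function.iterate_succ_apply', Function.iterate_succ_apply', view_step, ih]

theorem iterate_step_eq_self (x : Bool) (σ : Perm (Fin (d + 1))) :
    (step x)^[d - (view x σ (Fin.last d) : ℕ)] σ = σ := by
  rw [← view_view x ((step x)^[_] σ), view_iterate_step, iterate_topMove_eq_self, view_view]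

theorem redStep_iff (σ ρ : Perm (Fin (d + 1))) :
    (redStepT σ ρ ∨ redStepB σ ρ) ↔
      ∃ x : Bool, (view x σ (Fin.last d) : ℕ) ≠ d ∧ ρ = step x σ := by
  rw [redStepT_iff, redStepB_iff, Bool.exists_bool, or_comm]
  rfl

/-- The result of applying a word of moves to `τ`, the head of the list being applied last. -/
noncomputable def run (τ : Perm (Fin (d + 1))) (w : List Bool) : Perm (Fin (d + 1)) :=
  w.foldr step τ

/-- Between positions `s` and `d`, both excluded, `σ` is the reversal `i ↦ d + s - i`. -/
def ReversesAbove (s : ℕ) (σ : Perm (Fin (d + 1))) : Prop :=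
  ∀ i : Fin (d + 1), s < (i : ℕ) → (i : ℕ) < d → (σ i : ℕ) + i = d + s

theorem ReversesAbove.inv {s : ℕ} {σ : Perm (Fin (d + 1))} (h : ReversesAbove s σ) :
    ReversesAbove s σ⁻¹ := by
  intro i h₁ h₂
  have h₃ := h ⟨d + s - i, by omega⟩ (by simp; omega) (by simp; omega)
  have h₄ : σ ⟨d + s - i, by omega⟩ = i := Fin.ext (by simp at h₃; omega)
  have h₅ : (σ⁻¹) i = ⟨d + s - i, by omega⟩ := by rw [Perm.inv_eq_iff_eq, h₄]
  rw [h₅]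
  simp
  omega

theorem ReversesAbove.topMove {s : ℕ} {σ : Perm (Fin (d + 1))} (h : ReversesAbove s σ)
    (hp : (σ (Fin.last d) : ℕ) ≤ s) : ReversesAbove (s + 1) (topMove σ) := by
  intro i h₁ h₂
  have := h i (by omega) h₂
  rw [topMove_val]
  split_ifs <;> omega

theorem ReversesAbove.topMove_inv_last {s : ℕ} {σ : Perm (Fin (d + 1))} (h : ReversesAbove s σ)
    (hp : (σ (Fin.last d) : ℕ) ≤ s) (hs : s + 1 < d) :
    (((ReducedRauzy.topMove σ)⁻¹) (Fin.last d) : ℕ) = s + 1 := by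
  have h₁ := h ⟨s + 1, by omega⟩ (by simp) (by simpa using hs)
  have h₂ : (ReducedRauzy.topMove σ)⁻¹ (Fin.last d) = ⟨s + 1, by omega⟩ := by
    rw [Perm.inv_eq_iff_eq]
    apply Fin.ext
    rw [topMove_val, Fin.val_last]
    simp only at h₁
    split_ifs <;> omega
  rw [h₂]

/-- The length of a word of moves once its final run of `x` moves is removed. -/
def strippedLength (x : Bool) (w : List Bool) : ℕ := (w.dropWhile (· == x)).length

theorem strippedLength_le (x : Bool) (w : List Bool) : strippedLength x w ≤ w.length :=
  (List.dropWhile_sublist _).length_le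

@[simp] theorem strippedLength_cons_self (x : Bool) (w : List Bool) :
    strippedLength x (x :: w) = strippedLength x w := by
  simp [strippedLength]

@[simp] theorem strippedLength_not_cons (x : Bool) (w : List Bool) :
    strippedLength (!x) (x :: w) = w.length + 1 := by
  cases x <;> simp [strippedLength]

theorem view_run_spec {τ : Perm (Fin (d + 1))} (hτ : ∀ i, (τ i : ℕ) = d - i) (w : List Bool)
    (hw : w.length < d) (x : Bool) :
    (view x (run τ w) (Fin.last d) : ℕ) = strippedLength x w ∧
      ReversesAbove w.length (view x (run τ w)) := by
  induction w generalizing x with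
  | nil =>
    have hrev : ReversesAbove 0 τ := fun i _ _ => by have := hτ i; omega
    cases x
    · refine ⟨?_, hrev.inv⟩
      have : (τ⁻¹) (Fin.last d) = 0 := by
        rw [Perm.inv_eq_iff_eq]
        exact Fin.ext (by simp [hτ])
      simp [view, run, this, strippedLength]
    · exact ⟨by simp [view, run, hτ, strippedLength], hrev⟩
  | cons y w ih =>
    rw [List.length_cons] at hw
    obtain ⟨h₁, h₂⟩ := ih (by omega) y
    have h₃ : (view y (run τ w) (Fin.last d) : ℕ) ≤ w.length := h₁ ▸ strippedLength_le y w
    have hv : view y (run τ (y :: w)) = topMove (view y (run τ w)) := view_step y _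
    obtain rfl | rfl : x = y ∨ x = !y := by cases x <;> cases y <;> simp
    · rw [hv, topMove_last, h₁, strippedLength_cons_self]
      exact ⟨rfl, h₂.topMove h₃⟩
    · rw [view_not, hv, h₂.topMove_inv_last h₃ hw, strippedLength_not_cons]
      exact ⟨rfl, (h₂.topMove h₃).inv⟩

theorem strippedLength_cons_injective {x y : Bool} {v w : List Bool}
    (h : ∀ z, strippedLength z (x :: v) = strippedLength z (y :: w)) : x = y := by
  by_contra hxy
  obtain rfl : y = !x := by cases x <;> cases y <;> simp_all
  have h₁ := h x
  have h₂ := h (!x)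
  have h₃ := strippedLength_not_cons (!x) w
  have := strippedLength_le x v
  have := strippedLength_le (!x) w
  simp only [Bool.not_not, strippedLength_cons_self, strippedLength_not_cons] at h₁ h₂ h₃
  omega

theorem run_injOn {τ : Perm (Fin (d + 1))} (hτ : ∀ i, (τ i : ℕ) = d - i) :
    Set.InjOn (run τ) {w | w.length < d} := by
  intro v
  induction v with
  | nil =>
    intro hv w hw h
    cases w with
    | nil => rfl
    | cons y w =>
      have h₁ := (view_run_spec hτ _ hw (!y)).1
      rw [← h, (view_run_spec hτ _ hv (!y)).1, strippedLength_not_cons] at h₁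
      simp [strippedLength] at h₁
  | cons x v ih =>
    intro hv w hw h
    cases w with
    | nil =>
      have h₁ := (view_run_spec hτ _ hv (!x)).1
      rw [h, (view_run_spec hτ _ hw (!x)).1, strippedLength_not_cons] at h₁
      simp [strippedLength] at h₁
    | cons y w =>
      obtain rfl : x = y := strippedLength_cons_injective fun z => by
        rw [← (view_run_spec hτ _ hv z).1, h, (view_run_spec hτ _ hw z).1]
      simp only [Set.mem_ofPred_eq, List.length_cons] at hv hw
      rw [ih (show v.length < d by omega) (show w.length < d by omega) (step_injective x h)]

theorem run_eq_iterate_step (τ : Perm (Fin (d + 1))) (x : Bool) (w : List Bool) :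
    run τ w = (step x)^[w.length - strippedLength x w] (run τ (w.dropWhile (· == x))) := by
  induction w with
  | nil => rfl
  | cons y w ih =>
    obtain rfl | rfl : x = y ∨ y = !x := by cases x <;> cases y <;> simp
    · have := strippedLength_le x w
      rw [strippedLength_cons_self, List.length_cons, Nat.sub_add_comm this,
        Function.iterate_succ_apply', List.dropWhile_cons_of_pos (by simp), ← ih]
      rfl
    · have h := strippedLength_not_cons (!x) w
      rw [Bool.not_not] at h
      rw [h, List.length_cons, Nat.sub_self, List.dropWhile_cons_of_neg (by simp)]
      rfl

/-- A move applied after a word of maximal length undoes the final run of that move. -/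
theorem step_run_of_length {τ : Perm (Fin (d + 1))} (hτ : ∀ i, (τ i : ℕ) = d - i) (x : Bool)
    (w : List Bool) (hw : w.length + 1 = d) :
    step x (run τ w) = run τ (w.dropWhile (· == x)) := by
  have hle := strippedLength_le x w
  have hu : (w.dropWhile (· == x)).length = strippedLength x w := rfl
  have h := (view_run_spec hτ (w.dropWhile (· == x)) (by omega) x).1
  have hs : strippedLength x (w.dropWhile (· == x)) = strippedLength x w := by
    simp [strippedLength, List.dropWhile_idempotent]
  have h' := iterate_step_eq_self x (run τ (w.dropWhile (· == x)))
  rw [h, hs, show d - strippedLength x w = (w.length - strippedLength x w) + 1 by omega,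
    Function.iterate_succ_apply', ← run_eq_iterate_step] at h'
  exact h'

theorem redRauzyClass_eq_image {τ : Perm (Fin (d + 1))} (hd : 0 < d)
    (hτ : ∀ i, (τ i : ℕ) = d - i) :
    redRauzyClass τ = run τ '' {w | w.length < d} := by
  ext σ
  constructor
  · intro h
    induction (show Relation.ReflTransGen _ τ σ from h) with
    | refl => exact ⟨[], hd, rfl⟩
    | tail hσ hstep ih =>
      obtain ⟨w, hw, rfl⟩ := ih hσ
      obtain ⟨x, -, rfl⟩ := (redStep_iff _ _).1 hstep
      obtain hlt | heq := Nat.lt_or_eq_of_le (Nat.succ_le_of_lt hw)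
      · exact ⟨x :: w, hlt, rfl⟩
      · exact ⟨_, lt_of_le_of_lt (strippedLength_le x w) hw,
          (step_run_of_length hτ x w heq).symm⟩
  · rintro ⟨w, hw, rfl⟩
    induction w with
    | nil => exact Relation.ReflTransGen.refl
    | cons x w ih =>
      have hw' : w.length < d := Nat.lt_of_succ_lt hw
      refine Relation.ReflTransGen.tail (ih hw') ((redStep_iff _ _).2 ⟨x, ?_, rfl⟩)
      rw [(view_run_spec hτ w hw' x).1]
      exact (lt_of_le_of_lt (strippedLength_le x w) hw').ne

theorem ncard_length_lt (d : ℕ) : {w : List Bool | w.length < d}.ncard = 2 ^ d - 1 := by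
  induction d with
  | zero => simp
  | succ d ih =>
    have hfin := List.finite_length_lt Bool d
    have hsplit : {w : List Bool | w.length < d + 1} =
        insert [] (List.cons true '' {w | w.length < d} ∪
          List.cons false '' {w | w.length < d}) := by
      ext w
      rcases w with _ | ⟨_ | _, w⟩ <;> simp
    have hdisj : Disjoint (List.cons true '' {w | w.length < d})
        (List.cons false '' {w | w.length < d}) := by
      rw [Set.disjoint_left]
      rintro _ ⟨v, -, rfl⟩ ⟨w, -, h⟩
      simp at h
    rw [hsplit, Set.ncard_insert_of_notMem (by simp) ((hfin.image _).union (hfin.image _)),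
      Set.ncard_union_eq hdisj (hfin.image _) (hfin.image _),
      Set.ncard_image_of_injective _ List.cons_injective,
      Set.ncard_image_of_injective _ List.cons_injective, ih, pow_succ]
    have := Nat.one_le_two_pow (n := d)
    omega

end ReducedRauzy

/-- For every `n ≥ 2`, the reduced Rauzy class of `τ_n : i ↦ n + 1 - i` (in 1-based
notation; in our 0-based encoding, `τ_n(i) = n - 1 - i`) is finite of cardinality
`2 ^ (n - 1) - 1`. -/
theorem redRauzyClass_reversal_card (n : ℕ) (hn : 2 ≤ n) (τ : Equiv.Perm (Fin n))
    (hτ : ∀ i : Fin n, (τ i : ℕ) = n - 1 - (i : ℕ)) :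
    (redRauzyClass τ).Finite ∧ (redRauzyClass τ).ncard = 2 ^ (n - 1) - 1 := by
  obtain ⟨d, rfl⟩ : ∃ d, n = d + 1 := ⟨n - 1, by omega⟩
  refine ⟨Set.toFinite _, ?_⟩
  rw [ReducedRauzy.redRauzyClass_eq_image (by omega) hτ,
    (ReducedRauzy.run_injOn hτ).ncard_image, ReducedRauzy.ncard_length_lt,
    Nat.add_sub_cancel]
end

section
/- For every integer n ≥ 2, let τ̃_n be the labeled permutation on the alphabet {1,…,n} given by π_t = identity and π_b(i) = n+1−i. Then the labeled Rauzy class R_lab(τ̃_n) is finite and has cardinality 2^(n−1) − 1 (the same cardinality as the corresponding reduced Rauzy class). -/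
/-!
A labeled permutation on a finite alphabet `A` with `|A| = d` is a pair of bijections
`A ≃ Fin d`, where the index `j - 1 : Fin d` corresponds to the position `j ∈ {1,…,d}`.
The labeled Rauzy moves are encoded as binary relations (empty when the move is
undefined, i.e. when `π_t⁻¹(d) = π_b⁻¹(d)`).
-/

/-- The labeled top Rauzy move `𝓡_t`, as a relation; `last` is the index corresponding
to the position `d`, and `p.2 (p.1.symm last)` corresponds to `k = π_b(π_t⁻¹(d))`. -/
def labStepT {A : Type*} {d : ℕ} (p p' : (A ≃ Fin d) × (A ≃ Fin d)) : Prop :=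
  ∀ last : Fin d, (last : ℕ) + 1 = d →
    p.1.symm last ≠ p.2.symm last ∧ p'.1 = p.1 ∧
    ∀ j : Fin d,
      ((j : ℕ) ≤ (p.2 (p.1.symm last) : ℕ) → p'.2.symm j = p.2.symm j) ∧
      ((j : ℕ) = (p.2 (p.1.symm last) : ℕ) + 1 → p'.2.symm j = p.2.symm last) ∧
      ((p.2 (p.1.symm last) : ℕ) + 1 < (j : ℕ) →
        ∀ i : Fin d, (i : ℕ) + 1 = (j : ℕ) → p'.2.symm j = p.2.symm i)

/-- The labeled bottom Rauzy move `𝓡_b`, as a relation (same formulas with the roles of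
`π_t` and `π_b` exchanged). -/
def labStepB {A : Type*} {d : ℕ} (p p' : (A ≃ Fin d) × (A ≃ Fin d)) : Prop :=
  ∀ last : Fin d, (last : ℕ) + 1 = d →
    p.1.symm last ≠ p.2.symm last ∧ p'.2 = p.2 ∧
    ∀ j : Fin d,
      ((j : ℕ) ≤ (p.1 (p.2.symm last) : ℕ) → p'.1.symm j = p.1.symm j) ∧
      ((j : ℕ) = (p.1 (p.2.symm last) : ℕ) + 1 → p'.1.symm j = p.1.symm last) ∧
      ((p.1 (p.2.symm last) : ℕ) + 1 < (j : ℕ) →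
        ∀ i : Fin d, (i : ℕ) + 1 = (j : ℕ) → p'.1.symm j = p.1.symm i)

/-- The labeled Rauzy class of `p`: the smallest set of labeled permutations containing
`p` and stable under the two labeled Rauzy moves. -/
def labRauzyClass {A : Type*} {d : ℕ} (p : (A ≃ Fin d) × (A ≃ Fin d)) :
    Set ((A ≃ Fin d) × (A ≃ Fin d)) :=
  {q | Relation.ReflTransGen (fun a b => labStepT a b ∨ labStepB a b) p q}

/-- The row of letters `π⁻¹(1), …, π⁻¹(d)` of a bijection `π : Fin n ≃ Fin d`. -/
def letterRow {n d : ℕ} (e : Fin n ≃ Fin d) : List ℕ :=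
  List.ofFn fun i => (e.symm i : ℕ)

lemma length_letterRow {n d : ℕ} (e : Fin n ≃ Fin d) : (letterRow e).length = d := by
  simp [letterRow]

lemma getElem_letterRow {n d : ℕ} (e : Fin n ≃ Fin d) (i : ℕ) (h : i < (letterRow e).length) :
    (letterRow e)[i] = (e.symm ⟨i, by simpa [letterRow] using h⟩ : ℕ) := by
  simp [letterRow]

lemma nodup_letterRow {n d : ℕ} (e : Fin n ≃ Fin d) : (letterRow e).Nodup :=
  List.nodup_ofFn.2 (Fin.val_injective.comp e.symm.injective)

lemma letterRow_injective {n d : ℕ} : Function.Injective (letterRow (n := n) (d := d)) := by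
  intro e f h
  have hfun := List.ofFn_injective h
  apply Equiv.symm_bijective.injective
  ext i
  exact congrFun hfun i

/-- Every rearrangement of a row of letters is a row of letters. -/
lemma exists_letterRow_eq_of_perm {n d : ℕ} (e : Fin n ≃ Fin d) {l : List ℕ}
    (h : l.Perm (letterRow e)) : ∃ f : Fin n ≃ Fin d, letterRow f = l := by
  have hlen : l.length = d := by rw [h.length_eq, length_letterRow]
  have hnd : l.Nodup := h.nodup_iff.2 (nodup_letterRow e)
  have hcard : n = d := by simpa using Fintype.card_congr e
  have hlt : ∀ x ∈ l, x < n := by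
    intro x hx
    obtain ⟨i, rfl⟩ := (List.mem_ofFn' _ _).1 (h.mem_iff.1 hx)
    exact (e.symm i).isLt
  let g : Fin d → Fin n := fun i =>
    ⟨l[(i : ℕ)]'(by omega), hlt _ (List.getElem_mem _)⟩
  have hg : Function.Injective g := by
    intro i j hij
    have := congrArg Fin.val hij
    exact Fin.ext ((hnd.getElem_inj_iff).1 this)
  have hb : Function.Bijective g :=
    (Fintype.bijective_iff_injective_and_card g).2 ⟨hg, by simp [hcard]⟩
  refine ⟨(Equiv.ofBijective g hb).symm, ?_⟩
  apply List.ext_getElem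
  · rw [length_letterRow, hlen]
  · intro i h₁ h₂
    simp [getElem_letterRow, g]

section InsertLast

variable {α : Type*} {X Y : List α} {a c : α}

lemma getElem_insertLast_of_le {i : ℕ} (h : i ≤ X.length) :
    (X ++ a :: c :: Y)[i]'(by simp; omega) = (X ++ a :: (Y ++ [c]))[i]'(by simp; omega) := by
  rcases h.lt_or_eq with h | rfl
  · rw [List.getElem_append_left h, List.getElem_append_left h]
  · simp

lemma getElem_insertLast_length_add_one :
    (X ++ a :: c :: Y)[X.length + 1]'(by simp) = c := by
  simp [List.getElem_append_right]

lemma getElem_last_append_cons_concat {i : ℕ} (h : i = X.length + Y.length + 1) :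
    (X ++ a :: (Y ++ [c]))[i]'(by simp; omega) = c := by
  subst h
  simp [List.getElem_append_right, add_assoc]

lemma getElem_insertLast_succ {i : ℕ} (h : X.length < i) (hi : i < X.length + Y.length + 1) :
    (X ++ a :: c :: Y)[i + 1]'(by simp; omega) =
      (X ++ a :: (Y ++ [c]))[i]'(by simp; omega) := by
  obtain ⟨k, rfl⟩ := Nat.exists_eq_add_of_lt h
  have hk : k < Y.length := by omega
  simp [List.getElem_append_right, List.getElem_append_left hk, add_assoc]

end InsertLast

/-- On rows of letters, the top move inserts the last letter of the bottom row right after the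
occurrence in the bottom row of the last letter of the top row. -/
lemma labStepT_iff_letterRow {n d : ℕ} {p p' : (Fin n ≃ Fin d) × (Fin n ≃ Fin d)}
    {X Y Z : List ℕ} {a c : ℕ} (ht : letterRow p.1 = Z ++ [a])
    (hb : letterRow p.2 = X ++ a :: (Y ++ [c])) :
    labStepT p p' ↔ letterRow p'.1 = letterRow p.1 ∧ letterRow p'.2 = X ++ a :: c :: Y := by
  have hZ : Z.length + 1 = d := by simpa [length_letterRow] using (congrArg List.length ht).symm
  have hXY : X.length + Y.length + 2 = d := by
    have := congrArg List.length hb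
    simp [length_letterRow] at this
    omega
  have hnd := nodup_letterRow p.2
  have hac : a ≠ c := by
    rw [hb] at hnd
    rintro rfl
    simp [List.nodup_append] at hnd
  have hlast : (p.1.symm ⟨d - 1, by omega⟩ : ℕ) = a := by
    rw [← getElem_letterRow p.1 (d - 1) (by rw [length_letterRow]; omega)]
    simp only [ht, List.getElem_append]
    grind
  have hval : ∀ (i : ℕ) (hi : i < d),
      (p.2.symm ⟨i, hi⟩ : ℕ) = (X ++ a :: (Y ++ [c]))[i]'(by simp; omega) := by
    intro i hi
    rw [← getElem_letterRow p.2 i (by rw [length_letterRow]; omega)]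
    simp only [hb]
  have hk : p.2 (p.1.symm ⟨d - 1, by omega⟩) = ⟨X.length, by omega⟩ := by
    rw [← Equiv.eq_symm_apply]
    apply Fin.ext
    rw [hlast, hval]
    simp
  have hval' : ∀ (i : ℕ) (hi : i < d), (p'.2.symm ⟨i, hi⟩ : ℕ) =
      (letterRow p'.2)[i]'(by rw [length_letterRow]; omega) := by
    intro i hi
    rw [getElem_letterRow]
  constructor
  · intro h
    obtain ⟨-, h1, h2⟩ := h ⟨d - 1, by omega⟩ (by simp; omega)
    refine ⟨by rw [h1], ?_⟩
    apply List.ext_getElem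
    · simp [length_letterRow]; omega
    · intro i hi hi'
      have hid : i < d := by simpa [length_letterRow] using hi
      obtain ⟨h3, h4, h5⟩ := h2 ⟨i, hid⟩
      rw [hk] at h3 h4 h5
      rw [← hval' i hid]
      simp only at h3 h4 h5
      rcases lt_trichotomy i (X.length + 1) with hlt | rfl | hgt
      · rw [h3 (by omega), hval, getElem_insertLast_of_le (by omega)]
      · rw [h4 rfl, hval, getElem_insertLast_length_add_one,
          getElem_last_append_cons_concat (by omega)]
      · obtain ⟨j, rfl⟩ := Nat.exists_eq_succ_of_ne_zero (show i ≠ 0 by omega)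
        rw [h5 hgt ⟨j, by omega⟩ rfl, hval, getElem_insertLast_succ (by omega) (by omega)]
  · rintro ⟨h1, h2⟩ last hl
    have hd : d - 1 < d := by omega
    obtain rfl : last = ⟨d - 1, hd⟩ := Fin.ext (by simp; omega)
    simp only [h2] at hval'
    refine ⟨?_, letterRow_injective h1, ?_⟩
    · intro h
      have := congrArg Fin.val h
      rw [hlast, hval, getElem_last_append_cons_concat (by omega)] at this
      exact hac this
    · rintro ⟨j, hj⟩
      rw [hk]
      refine ⟨fun h => Fin.ext ?_, fun h => Fin.ext ?_, fun h => ?_⟩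
      · rw [hval', hval, getElem_insertLast_of_le h]
      · obtain rfl : j = X.length + 1 := h
        rw [hval', hval, getElem_insertLast_length_add_one,
          getElem_last_append_cons_concat (by omega)]
      · rintro ⟨i, hi⟩ hij
        obtain rfl : i + 1 = j := hij
        simp only at h
        exact Fin.ext (by rw [hval', hval, getElem_insertLast_succ (by omega) (by omega)])

lemma labStepB_iff_labStepT_swap {A : Type*} {d : ℕ} {p p' : (A ≃ Fin d) × (A ≃ Fin d)} :
    labStepB p p' ↔ labStepT p.swap p'.swap := by
  simp only [labStepB, labStepT, Prod.fst_swap, Prod.snd_swap, ne_comm]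

/-- On rows of letters, the bottom move inserts the last letter of the top row right after the
occurrence in the top row of the last letter of the bottom row. -/
lemma labStepB_iff_letterRow {n d : ℕ} {p p' : (Fin n ≃ Fin d) × (Fin n ≃ Fin d)}
    {X Y Z : List ℕ} {a c : ℕ} (hb : letterRow p.2 = Z ++ [a])
    (ht : letterRow p.1 = X ++ a :: (Y ++ [c])) :
    labStepB p p' ↔ letterRow p'.1 = X ++ a :: c :: Y ∧ letterRow p'.2 = letterRow p.2 := by
  rw [labStepB_iff_labStepT_swap, labStepT_iff_letterRow (p := p.swap) hb ht, and_comm]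
  rfl

/-- The pair of rows `P lo Q (lo+1) … hi` and `P' hi Q' (hi-1) … lo`. -/
structure RauzyRows where
  /-- The letters of the top row before `lo`. -/
  topPre : List ℕ
  /-- The letters of the top row between `lo` and `lo + 1`. -/
  topMid : List ℕ
  /-- The letters of the bottom row before `hi`. -/
  botPre : List ℕ
  /-- The letters of the bottom row between `hi` and `hi - 1`. -/
  botMid : List ℕ
  /-- The last letter of the bottom row. -/
  lo : ℕ
  /-- The last letter of the top row. -/
  hi : ℕ

namespace RauzyRows

/-- The top row. -/
def top (s : RauzyRows) : List ℕ :=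
  s.topPre ++ s.lo :: (s.topMid ++ List.range' (s.lo + 1) (s.hi - s.lo))

/-- The bottom row. -/
def bot (s : RauzyRows) : List ℕ :=
  s.botPre ++ s.hi :: (s.botMid ++ (List.range' s.lo (s.hi - s.lo)).reverse)

/-- The effect of the top move when `lo + 1 < hi`. -/
def stepT (s : RauzyRows) : RauzyRows where
  topPre := s.topPre ++ s.lo :: s.topMid
  topMid := []
  botPre := s.botPre
  botMid := s.lo :: s.botMid
  lo := s.lo + 1
  hi := s.hi

/-- The effect of the bottom move when `lo + 1 < hi`. -/
def stepB (s : RauzyRows) : RauzyRows where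
  topPre := s.topPre
  topMid := s.hi :: s.topMid
  botPre := s.botPre ++ s.hi :: s.botMid
  botMid := []
  lo := s.lo
  hi := s.hi - 1

/-- The rows obtained from the reversal of `n` letters by a word of moves, the most recent move
coming first; `true` stands for the top move and `false` for the bottom move. -/
def ofWord (n : ℕ) : List Bool → RauzyRows
  | [] => ⟨[], [], [], [], 0, n - 1⟩
  | true :: w => (ofWord n w).stepT
  | false :: w => (ofWord n w).stepB

lemma range'_eq_cons {a b : ℕ} (h : a < b) :
    List.range' a (b - a) = a :: List.range' (a + 1) (b - (a + 1)) := by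
  obtain ⟨k, rfl⟩ := Nat.exists_eq_add_of_lt h
  rw [show a + k + 1 - a = k + 1 by omega, show a + k + 1 - (a + 1) = k by omega,
    List.range'_succ]

lemma range'_succ_eq_concat {a b : ℕ} (h : a < b) :
    List.range' (a + 1) (b - a) = List.range' (a + 1) (b - 1 - a) ++ [b] := by
  obtain ⟨k, rfl⟩ := Nat.exists_eq_add_of_lt h
  rw [show a + k + 1 - a = k + 1 by omega, show a + k + 1 - 1 - a = k by omega,
    List.range'_concat]
  simp; omega

lemma top_eq_concat {s : RauzyRows} (h : s.lo < s.hi) :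
    s.top = s.topPre ++ s.lo :: (s.topMid ++ List.range' (s.lo + 1) (s.hi - 1 - s.lo) ++
      [s.hi]) := by
  rw [top, range'_succ_eq_concat h, List.append_assoc]

lemma bot_eq_concat {s : RauzyRows} (h : s.lo < s.hi) :
    s.bot = s.botPre ++ s.hi ::
      (s.botMid ++ (List.range' (s.lo + 1) (s.hi - (s.lo + 1))).reverse ++ [s.lo]) := by
  rw [bot, range'_eq_cons h, List.reverse_cons, List.append_assoc]

lemma top_stepT {s : RauzyRows} (h : s.lo + 1 < s.hi) : s.stepT.top = s.top := by
  simp [top, stepT, show s.hi - s.lo = s.hi - (s.lo + 1) + 1 by omega, List.range'_succ]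

lemma bot_stepT (s : RauzyRows) : s.stepT.bot = s.botPre ++ s.hi ::
    s.lo :: (s.botMid ++ (List.range' (s.lo + 1) (s.hi - (s.lo + 1))).reverse) := rfl

lemma bot_stepB {s : RauzyRows} (h : s.lo + 1 < s.hi) : s.stepB.bot = s.bot := by
  obtain ⟨k, hk⟩ := Nat.exists_eq_add_of_lt h
  simp [bot, stepB, hk, show s.lo + 1 + k + 1 - s.lo = k + 1 + 1 by omega,
    show s.lo + 1 + k - s.lo = k + 1 by omega, List.range'_concat]
  omega

lemma top_stepB (s : RauzyRows) : s.stepB.top = s.topPre ++ s.lo ::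
    s.hi :: (s.topMid ++ List.range' (s.lo + 1) (s.hi - 1 - s.lo)) := rfl

lemma lo_ofWord (n : ℕ) (w : List Bool) : (ofWord n w).lo = w.count true := by
  induction w with
  | nil => rfl
  | cons x w ih => cases x <;> simp [ofWord, stepT, stepB, ih]

lemma hi_ofWord (n : ℕ) (w : List Bool) : (ofWord n w).hi = n - 1 - w.count false := by
  induction w with
  | nil => rfl
  | cons x w ih => cases x <;> simp [ofWord, stepT, stepB, ih]; omega

lemma hi_sub_lo_ofWord {n : ℕ} {w : List Bool} (h : w.length + 2 ≤ n) :
    (ofWord n w).hi + w.length + 1 = (ofWord n w).lo + n := by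
  have := List.count_true_add_count_false w
  rw [lo_ofWord, hi_ofWord]
  omega

lemma top_bot_dropWhile_true {n : ℕ} {w : List Bool} (h : w.length + 2 ≤ n) :
    (ofWord n (w.dropWhile (· = true))).top = (ofWord n w).top ∧
    (ofWord n (w.dropWhile (· = true))).bot = (ofWord n w).botPre ++ (ofWord n w).hi ::
      ((List.range' (ofWord n w).lo ((ofWord n w).hi - (ofWord n w).lo)).reverse ++
        (ofWord n w).botMid) := by
  induction w with
  | nil => simp [bot, ofWord]
  | cons x w ih =>
    simp only [List.length_cons] at h
    have hlo := hi_sub_lo_ofWord (n := n) (w := w) (by omega)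
    cases x with
    | false => simp [bot, ofWord, stepB]
    | true =>
      obtain ⟨ih1, ih2⟩ := ih (by omega)
      simp only [decide_true, List.dropWhile_cons_of_pos]
      rw [ih1, ih2, range'_eq_cons (by omega)]
      exact ⟨(top_stepT (by omega)).symm, by simp [ofWord, stepT]⟩

lemma top_bot_dropWhile_false {n : ℕ} {w : List Bool} (h : w.length + 2 ≤ n) :
    (ofWord n (w.dropWhile (· = false))).bot = (ofWord n w).bot ∧
    (ofWord n (w.dropWhile (· = false))).top = (ofWord n w).topPre ++ (ofWord n w).lo ::
      (List.range' ((ofWord n w).lo + 1) ((ofWord n w).hi - (ofWord n w).lo) ++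
        (ofWord n w).topMid) := by
  induction w with
  | nil => simp [top, ofWord]
  | cons x w ih =>
    simp only [List.length_cons] at h
    have hlo := hi_sub_lo_ofWord (n := n) (w := w) (by omega)
    cases x with
    | true => simp [top, ofWord, stepT]
    | false =>
      obtain ⟨ih1, ih2⟩ := ih (by omega)
      simp only [decide_true, List.dropWhile_cons_of_pos]
      rw [ih1, ih2, range'_succ_eq_concat (by omega)]
      exact ⟨(bot_stepB (by omega)).symm, by simp [ofWord, stepB]⟩

/-- The pair of rows attached to a word of moves. -/
def rows (n : ℕ) (w : List Bool) : List ℕ × List ℕ := ((ofWord n w).top, (ofWord n w).bot)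

/-- The action of the top move on words. -/
def wordT (n : ℕ) (w : List Bool) : List Bool :=
  if w.length + 2 < n then true :: w else w.dropWhile (· = true)

/-- The action of the bottom move on words. -/
def wordB (n : ℕ) (w : List Bool) : List Bool :=
  if w.length + 2 < n then false :: w else w.dropWhile (· = false)

lemma length_wordT {n : ℕ} {w : List Bool} (h : w.length + 2 ≤ n) :
    (wordT n w).length + 2 ≤ n := by
  have := (List.dropWhile_sublist (l := w) (· = true)).length_le
  unfold wordT
  split_ifs
  · simp; omega
  · omega

lemma length_wordB {n : ℕ} {w : List Bool} (h : w.length + 2 ≤ n) :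
    (wordB n w).length + 2 ≤ n := by
  have := (List.dropWhile_sublist (l := w) (· = false)).length_le
  unfold wordB
  split_ifs
  · simp; omega
  · omega

lemma rows_wordT {n : ℕ} {w : List Bool} (h : w.length + 2 ≤ n) :
    rows n (wordT n w) = ((ofWord n w).top, (ofWord n w).botPre ++ (ofWord n w).hi ::
      (ofWord n w).lo :: ((ofWord n w).botMid ++ (List.range' ((ofWord n w).lo + 1)
        ((ofWord n w).hi - ((ofWord n w).lo + 1))).reverse)) := by
  have hlo := hi_sub_lo_ofWord h
  unfold wordT rows
  split_ifs with hw
  · exact Prod.ext (top_stepT (by omega)) (bot_stepT _)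
  · obtain ⟨h1, h2⟩ := top_bot_dropWhile_true h
    have hhi : (ofWord n w).hi = (ofWord n w).lo + 1 := by omega
    rw [h1, h2]
    simp [hhi]

lemma rows_wordB {n : ℕ} {w : List Bool} (h : w.length + 2 ≤ n) :
    rows n (wordB n w) = ((ofWord n w).topPre ++ (ofWord n w).lo ::
      (ofWord n w).hi :: ((ofWord n w).topMid ++ List.range' ((ofWord n w).lo + 1)
        ((ofWord n w).hi - 1 - (ofWord n w).lo)), (ofWord n w).bot) := by
  have hlo := hi_sub_lo_ofWord h
  unfold wordB rows
  split_ifs with hw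
  · exact Prod.ext (top_stepB _) (bot_stepB (by omega))
  · obtain ⟨h1, h2⟩ := top_bot_dropWhile_false h
    have hhi : (ofWord n w).hi = (ofWord n w).lo + 1 := by omega
    rw [h1, h2]
    simp [hhi]

end RauzyRows

open RauzyRows

/-- The two rows of letters of a labeled permutation. -/
def letterRows {n d : ℕ} (p : (Fin n ≃ Fin d) × (Fin n ≃ Fin d)) : List ℕ × List ℕ :=
  (letterRow p.1, letterRow p.2)

lemma letterRows_injective {n d : ℕ} : Function.Injective (letterRows (n := n) (d := d)) :=
  letterRow_injective.prodMap letterRow_injective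

lemma labStepT_iff_rows {n d : ℕ} {p p' : (Fin n ≃ Fin d) × (Fin n ≃ Fin d)} {w : List Bool}
    (hw : w.length + 2 ≤ n) (hp : letterRows p = rows n w) :
    labStepT p p' ↔ letterRows p' = rows n (wordT n w) := by
  have hlo := hi_sub_lo_ofWord hw
  obtain ⟨h1, h2⟩ := Prod.ext_iff.1 hp
  have h1' : letterRow p.1 = (ofWord n w).top := h1
  have h2' : letterRow p.2 = (ofWord n w).bot := h2
  have ht := h1'.trans (top_eq_concat (by omega))
  have hb := h2'.trans (bot_eq_concat (by omega))
  rw [rows_wordT hw, labStepT_iff_letterRow (ht.trans (by rw [← List.cons_append,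
    ← List.append_assoc])) hb, h1', letterRows, Prod.ext_iff]

lemma labStepB_iff_rows {n d : ℕ} {p p' : (Fin n ≃ Fin d) × (Fin n ≃ Fin d)} {w : List Bool}
    (hw : w.length + 2 ≤ n) (hp : letterRows p = rows n w) :
    labStepB p p' ↔ letterRows p' = rows n (wordB n w) := by
  have hlo := hi_sub_lo_ofWord hw
  obtain ⟨h1, h2⟩ := Prod.ext_iff.1 hp
  have h1' : letterRow p.1 = (ofWord n w).top := h1
  have h2' : letterRow p.2 = (ofWord n w).bot := h2
  have ht := h1'.trans (top_eq_concat (by omega))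
  have hb := h2'.trans (bot_eq_concat (by omega))
  rw [rows_wordB hw, labStepB_iff_letterRow (hb.trans (by rw [← List.cons_append,
    ← List.append_assoc])) ht, h2', letterRows, Prod.ext_iff]

lemma exists_letterRows_wordT {n d : ℕ} {p : (Fin n ≃ Fin d) × (Fin n ≃ Fin d)} {w : List Bool}
    (hw : w.length + 2 ≤ n) (hp : letterRows p = rows n w) :
    ∃ p' : (Fin n ≃ Fin d) × (Fin n ≃ Fin d), letterRows p' = rows n (wordT n w) := by
  have hlo := hi_sub_lo_ofWord hw
  have h1 : letterRow p.1 = (ofWord n w).top := congrArg Prod.fst hp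
  have h2 : letterRow p.2 = (ofWord n w).bot := congrArg Prod.snd hp
  rw [rows_wordT hw]
  obtain ⟨f, hf⟩ := exists_letterRow_eq_of_perm p.2
    (l := (ofWord n w).botPre ++ (ofWord n w).hi ::
      (ofWord n w).lo :: ((ofWord n w).botMid ++ (List.range' ((ofWord n w).lo + 1)
        ((ofWord n w).hi - ((ofWord n w).lo + 1))).reverse)) (by
      rw [h2, bot_eq_concat (by omega)]
      exact ((List.perm_append_singleton _ _).symm.cons _).append_left _)
  exact ⟨(p.1, f), Prod.ext h1 hf⟩

lemma exists_letterRows_wordB {n d : ℕ} {p : (Fin n ≃ Fin d) × (Fin n ≃ Fin d)} {w : List Bool}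
    (hw : w.length + 2 ≤ n) (hp : letterRows p = rows n w) :
    ∃ p' : (Fin n ≃ Fin d) × (Fin n ≃ Fin d), letterRows p' = rows n (wordB n w) := by
  have hlo := hi_sub_lo_ofWord hw
  have h1 : letterRow p.1 = (ofWord n w).top := congrArg Prod.fst hp
  have h2 : letterRow p.2 = (ofWord n w).bot := congrArg Prod.snd hp
  rw [rows_wordB hw]
  obtain ⟨f, hf⟩ := exists_letterRow_eq_of_perm p.1
    (l := (ofWord n w).topPre ++ (ofWord n w).lo ::
      (ofWord n w).hi :: ((ofWord n w).topMid ++ List.range' ((ofWord n w).lo + 1)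
        ((ofWord n w).hi - 1 - (ofWord n w).lo))) (by
      rw [h1, top_eq_concat (by omega)]
      exact ((List.perm_append_singleton _ _).symm.cons _).append_left _)
  exact ⟨(f, p.2), Prod.ext hf h2⟩

lemma letterRows_reversal {n : ℕ} (τ : Fin n ≃ Fin n)
    (hτ : ∀ i : Fin n, (τ i : ℕ) = n - 1 - (i : ℕ)) (hn : 2 ≤ n) :
    letterRows (Equiv.refl (Fin n), τ) = rows n [] := by
  have hτ' : ∀ i : Fin n, (τ.symm i : ℕ) = n - 1 - (i : ℕ) := by
    intro i
    have := hτ (τ.symm i)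
    rw [Equiv.apply_symm_apply] at this
    omega
  apply Prod.ext <;> apply List.ext_getElem
  · simp [letterRows, rows, length_letterRow, top, ofWord]
    omega
  · intro i h1 h2
    simp only [letterRows, rows, getElem_letterRow, top, ofWord]
    cases i <;> simp [add_comm]
  · simp [letterRows, rows, length_letterRow, bot, ofWord]
    omega
  · intro i h1 h2
    simp only [letterRows, rows, getElem_letterRow, bot, ofWord, hτ']
    cases i <;> simp
    omega

/-- The rows of letters in the labeled Rauzy class of the reversal of `n` letters are those
attached to the words of length at most `n - 2`. -/
lemma image_letterRows_labRauzyClass {n : ℕ} (hn : 2 ≤ n) (τ : Fin n ≃ Fin n)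
    (hτ : ∀ i : Fin n, (τ i : ℕ) = n - 1 - (i : ℕ)) :
    letterRows '' labRauzyClass (Equiv.refl (Fin n), τ) =
      rows n '' {w | w.length + 2 ≤ n} := by
  apply Set.Subset.antisymm
  · rintro _ ⟨q, hq, rfl⟩
    induction hq with
    | refl => exact ⟨[], by simpa using hn, (letterRows_reversal τ hτ hn).symm⟩
    | tail _ hstep ih =>
      obtain ⟨w, hw, hq⟩ := ih
      rcases hstep with h | h
      · exact ⟨_, length_wordT hw, ((labStepT_iff_rows hw hq.symm).1 h).symm⟩
      · exact ⟨_, length_wordB hw, ((labStepB_iff_rows hw hq.symm).1 h).symm⟩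
  · rintro _ ⟨w, hw, rfl⟩
    induction w with
    | nil => exact ⟨_, Relation.ReflTransGen.refl, letterRows_reversal τ hτ hn⟩
    | cons x w ih =>
      have hw' : w.length + 2 < n := by simp only [Set.mem_ofPred_eq, List.length_cons] at hw; omega
      obtain ⟨q, hq, hqw⟩ := ih hw'.le
      cases x with
      | true =>
        have hcons : wordT n w = true :: w := if_pos hw'
        obtain ⟨q', hq'⟩ := exists_letterRows_wordT hw'.le hqw
        exact ⟨q', hq.tail (Or.inl ((labStepT_iff_rows hw'.le hqw).2 hq')), by rw [hq', hcons]⟩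
      | false =>
        have hcons : wordB n w = false :: w := if_pos hw'
        obtain ⟨q', hq'⟩ := exists_letterRows_wordB hw'.le hqw
        exact ⟨q', hq.tail (Or.inr ((labStepB_iff_rows hw'.le hqw).2 hq')), by rw [hq', hcons]⟩

lemma append_cons_inj_of_nodup {α : Type*} {x₁ x₂ y₁ y₂ : List α} {a : α}
    (hnd : (x₁ ++ a :: y₁).Nodup) (h : x₁ ++ a :: y₁ = x₂ ++ a :: y₂) : x₁ = x₂ ∧ y₁ = y₂ := by
  obtain ⟨-, hy, hxy⟩ := List.nodup_append.1 hnd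
  obtain ⟨hx, -, hy⟩ := (List.append_cons_inj_of_notMem
    (fun ha => hxy a ha a List.mem_cons_self rfl) (List.nodup_cons.1 hy).1).1 h
  exact ⟨hx, hy⟩

lemma lo_hi_eq_of_rows_eq {n : ℕ} {v w : List Bool} (hv : v.length + 2 ≤ n)
    (hw : w.length + 2 ≤ n) (h : rows n v = rows n w) :
    (ofWord n v).lo = (ofWord n w).lo ∧ (ofWord n v).hi = (ofWord n w).hi := by
  have hv' := hi_sub_lo_ofWord hv
  have hw' := hi_sub_lo_ofWord hw
  obtain ⟨ht, hb⟩ := Prod.ext_iff.1 h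
  simp only [rows] at ht hb
  rw [top_eq_concat (by omega), top_eq_concat (by omega)] at ht
  rw [bot_eq_concat (by omega), bot_eq_concat (by omega)] at hb
  have ht' := congrArg List.getLast? ht
  have hb' := congrArg List.getLast? hb
  simp only [← List.cons_append, ← List.append_assoc, List.getLast?_concat, Option.some.injEq]
    at ht' hb'
  exact ⟨hb', ht'⟩

lemma rows_cons_true_ne_cons_false {n : ℕ} {v w : List Bool} (hv : v.length + 1 + 2 ≤ n)
    (hw : w.length + 1 + 2 ≤ n) (hnd : (rows n (true :: v)).1.Nodup) :
    rows n (true :: v) ≠ rows n (false :: w) := by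
  intro h
  have hlohi := lo_hi_eq_of_rows_eq (by simpa using hv) (by simpa using hw) h
  have hv' := hi_sub_lo_ofWord (n := n) (w := true :: v) (by simpa using hv)
  have hw' := hi_sub_lo_ofWord (n := n) (w := w) (by omega)
  have ht : (ofWord n (true :: v)).top = (ofWord n (false :: w)).top := congrArg Prod.fst h
  change (ofWord n (true :: v)).top.Nodup at hnd
  rw [top] at ht hnd
  rw [hlohi.1] at ht hnd
  have := (append_cons_inj_of_nodup hnd ht).2
  rw [hlohi.2] at this
  simp only [ofWord, stepT, stepB, List.nil_append, List.cons_append] at this hlohi hv'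
  rw [List.length_cons] at hv'
  rw [show (ofWord n w).hi - 1 - (ofWord n w).lo = (ofWord n w).hi - 1 - (ofWord n w).lo - 1 + 1
    by omega, List.range'_succ, List.cons.injEq] at this
  omega

lemma injOn_rows {n : ℕ} (hnd : ∀ w : List Bool, w.length + 2 ≤ n →
    (rows n w).1.Nodup ∧ (rows n w).2.Nodup) :
    Set.InjOn (rows n) {w | w.length + 2 ≤ n} := by
  intro v
  induction v with
  | nil =>
    intro hv w hw h
    have hlohi := lo_hi_eq_of_rows_eq hv hw h
    have hv' := hi_sub_lo_ofWord hv
    have hw' := hi_sub_lo_ofWord hw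
    rw [List.length_nil] at hv'
    exact (List.length_eq_zero_iff.1 (by omega)).symm
  | cons x v ih =>
    intro hv w hw h
    have hlohi := lo_hi_eq_of_rows_eq hv hw h
    have hv' := hi_sub_lo_ofWord hv
    have hw' := hi_sub_lo_ofWord hw
    have hvn := hnd _ hv
    have hwn := hnd _ hw
    simp only [Set.mem_ofPred_eq, List.length_cons] at hv hw hv' ih
    cases w with
    | nil =>
      rw [List.length_nil] at hw'
      omega
    | cons y w =>
      rw [List.length_cons] at hw
      have hv'' := hi_sub_lo_ofWord (n := n) (w := v) (by omega)
      have hw'' := hi_sub_lo_ofWord (n := n) (w := w) (by omega)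
      cases x <;> cases y
      · congr 1
        refine ih (by omega) (show w.length + 2 ≤ n by omega) (Prod.ext ?_ ?_)
        · have ht : (ofWord n v).stepB.top = (ofWord n w).stepB.top := congrArg Prod.fst h
          have htn : (ofWord n v).stepB.top.Nodup := hvn.1
          have hlo : (ofWord n v).lo = (ofWord n w).lo := hlohi.1
          have hhi : (ofWord n v).hi = (ofWord n w).hi := by
            have : (ofWord n v).hi - 1 = (ofWord n w).hi - 1 := hlohi.2
            omega
          rw [top_stepB, hlo, hhi] at ht htn
          rw [top_stepB] at ht
          obtain ⟨hpre, hmid⟩ := append_cons_inj_of_nodup htn ht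
          simp only [List.cons.injEq, true_and, List.append_cancel_right_eq] at hmid
          simp only [rows, top, hlo, hhi, hpre, hmid]
        · have hb : (ofWord n v).stepB.bot = (ofWord n w).stepB.bot := congrArg Prod.snd h
          rwa [bot_stepB (by omega), bot_stepB (by omega)] at hb
      · exact absurd h.symm (rows_cons_true_ne_cons_false hw hv hwn.1)
      · exact absurd h (rows_cons_true_ne_cons_false hv hw hvn.1)
      · congr 1
        refine ih (by omega) (show w.length + 2 ≤ n by omega) (Prod.ext ?_ ?_)
        · have ht : (ofWord n v).stepT.top = (ofWord n w).stepT.top := congrArg Prod.fst h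
          rwa [top_stepT (by omega), top_stepT (by omega)] at ht
        · have hb : (ofWord n v).stepT.bot = (ofWord n w).stepT.bot := congrArg Prod.snd h
          have hbn : (ofWord n v).stepT.bot.Nodup := hvn.2
          have hhi : (ofWord n v).hi = (ofWord n w).hi := hlohi.2
          have hlo : (ofWord n v).lo = (ofWord n w).lo := Nat.succ_injective hlohi.1
          rw [bot_stepT, hlo, hhi] at hb hbn
          rw [bot_stepT] at hb
          obtain ⟨hpre, hmid⟩ := append_cons_inj_of_nodup hbn hb
          simp only [List.cons.injEq, true_and, List.append_cancel_right_eq] at hmid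
          simp only [rows, bot, hlo, hhi, hpre, hmid]

lemma ncard_length_lt (m : ℕ) : {w : List Bool | w.length < m}.ncard = 2 ^ m - 1 := by
  let e : {w : List Bool | w.length < m} ≃ Σ k : Fin m, List.Vector Bool k :=
    { toFun := fun w => ⟨⟨w.1.length, w.2⟩, ⟨w.1, rfl⟩⟩
      invFun := fun x => ⟨x.2.1, by simp⟩
      left_inv := fun _ => rfl
      right_inv := by
        rintro ⟨⟨k, hk⟩, ⟨w, hw⟩⟩
        obtain rfl : w.length = k := hw
        rfl }
  rw [← Nat.card_coe_set_eq, Nat.card_congr e, Nat.card_eq_fintype_card, Fintype.card_sigma]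
  simp only [card_vector, Fintype.card_bool]
  rw [Fin.sum_univ_eq_sum_range (fun k => 2 ^ k), Nat.geomSum_eq le_rfl]
  simp

/-- For every `n ≥ 2`, the labeled Rauzy class of `τ̃_n = (id, τ_n)` on the alphabet
`{1,…,n}` (encoded as `Fin n`), where `τ_n : i ↦ n + 1 - i` in 1-based notation
(`τ_n(i) = n - 1 - i` in our 0-based encoding), is finite of cardinality
`2 ^ (n - 1) - 1`, the same as the corresponding reduced Rauzy class. -/
theorem labRauzyClass_reversal_card (n : ℕ) (hn : 2 ≤ n) (τ : Fin n ≃ Fin n)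
    (hτ : ∀ i : Fin n, (τ i : ℕ) = n - 1 - (i : ℕ)) :
    (labRauzyClass (Equiv.refl (Fin n), τ)).Finite ∧
      (labRauzyClass (Equiv.refl (Fin n), τ)).ncard = 2 ^ (n - 1) - 1 := by
  refine ⟨Set.toFinite _, ?_⟩
  have himage := image_letterRows_labRauzyClass hn τ hτ
  have hnd : ∀ w : List Bool, w.length + 2 ≤ n →
      (rows n w).1.Nodup ∧ (rows n w).2.Nodup := by
    intro w hw
    obtain ⟨q, -, hq⟩ := himage.symm ▸ Set.mem_image_of_mem (rows n) hw
    rw [← hq]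
    exact ⟨nodup_letterRow _, nodup_letterRow _⟩
  rw [← Set.ncard_image_of_injective _ letterRows_injective, himage,
    (injOn_rows hnd).ncard_image, ← ncard_length_lt]
  congr 1
  ext w
  simp only [Set.mem_ofPred_eq]
  omega
end

section
/- For every integer n ≥ 2, let σ_n be the permutation of {1,…,n+1} defined by σ_n(1) = n+1, σ_n(j) = n+1−j for 2 ≤ j ≤ n−1, σ_n(n) = n, and σ_n(n+1) = 1 (σ_n is the reduction of the labeled permutation whose top row is 0, 2, 3, …, n−1, 1, n and whose bottom row is n, n−1, …, 2, 1, 0). Then the reduced Rauzy class R(σ_n) is finite and has cardinality 2^(n−1) − 1 + n. -/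
open Equiv (Perm)

variable {n : ℕ}

/-- The top Rauzy move as a function; it is the identity when `v` fixes the last letter. -/
noncomputable def topMove (v : Perm (Fin (n + 1))) : Perm (Fin (n + 1)) :=
  Equiv.ofBijective
    (fun j => (⟨if (v j : ℕ) ≤ v (Fin.last n) then (v j : ℕ)
      else if (v j : ℕ) = n then (v (Fin.last n) : ℕ) + 1 else (v j : ℕ) + 1, by
        split_ifs <;> omega⟩ : Fin (n + 1)))
    (Finite.injective_iff_bijective.1 fun i j h => by
      apply v.injective
      have h' := Fin.val_eq_of_eq h
      simp only at h'
      apply Fin.ext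
      split_ifs at h' <;> omega)

/-- The bottom Rauzy move as a function, conjugate of the top move by inversion. -/
noncomputable def botMove (v : Perm (Fin (n + 1))) : Perm (Fin (n + 1)) := (topMove v⁻¹)⁻¹

theorem topMove_val (v : Perm (Fin (n + 1))) (j : Fin (n + 1)) :
    (topMove v j : ℕ) = if (v j : ℕ) ≤ v (Fin.last n) then (v j : ℕ)
      else if (v j : ℕ) = n then (v (Fin.last n) : ℕ) + 1 else (v j : ℕ) + 1 := rfl

theorem topMove_inv (v : Perm (Fin (n + 1))) : topMove v⁻¹ = (botMove v)⁻¹ := by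
  simp [botMove]

theorem botMove_inv (v : Perm (Fin (n + 1))) : botMove v⁻¹ = (topMove v)⁻¹ := by
  simp [botMove]

theorem apply_inv_apply (v : Perm (Fin (n + 1))) (j : Fin (n + 1)) : v (v⁻¹ j) = j :=
  v.apply_symm_apply j

theorem inv_apply_apply (v : Perm (Fin (n + 1))) (j : Fin (n + 1)) : v⁻¹ (v j) = j :=
  v.symm_apply_apply j

theorem inv_val_eq_iff {v : Perm (Fin (n + 1))} {i j : Fin (n + 1)} :
    (v⁻¹ i : ℕ) = j ↔ (v j : ℕ) = i := by
  rw [Fin.val_inj, Fin.val_inj, Equiv.Perm.inv_eq_iff_eq, eq_comm]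

theorem botMove_apply_of_le {v : Perm (Fin (n + 1))} {j : Fin (n + 1)}
    (h : (j : ℕ) ≤ v⁻¹ (Fin.last n)) : botMove v j = v j := by
  rw [botMove, Equiv.Perm.inv_eq_iff_eq]
  apply Fin.ext
  rw [topMove_val, inv_apply_apply, if_pos h]

theorem botMove_apply_of_eq {v : Perm (Fin (n + 1))} {j : Fin (n + 1)}
    (h : (j : ℕ) = v⁻¹ (Fin.last n) + 1) : botMove v j = v (Fin.last n) := by
  rw [botMove, Equiv.Perm.inv_eq_iff_eq]
  apply Fin.ext
  rw [topMove_val]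
  have := j.isLt
  simp only [inv_apply_apply, Fin.val_last, if_true]
  rw [if_neg (by omega), h]

theorem botMove_apply_of_lt {v : Perm (Fin (n + 1))} {i j : Fin (n + 1)}
    (h : (v⁻¹ (Fin.last n) : ℕ) + 1 < j) (hij : (i : ℕ) + 1 = j) : botMove v j = v i := by
  rw [botMove, Equiv.Perm.inv_eq_iff_eq]
  apply Fin.ext
  rw [topMove_val]
  have := j.isLt
  simp only [inv_apply_apply]
  rw [if_neg (by omega), if_neg (by omega), hij]

theorem topMove_eq_self {v : Perm (Fin (n + 1))} (h : (v (Fin.last n) : ℕ) = n) :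
    topMove v = v := by
  ext j
  rw [topMove_val, if_pos (by omega)]

theorem botMove_eq_self {v : Perm (Fin (n + 1))} (h : (v (Fin.last n) : ℕ) = n) :
    botMove v = v := by
  rw [botMove, topMove_eq_self, inv_inv]
  exact inv_val_eq_iff (j := Fin.last n).2 (by simpa using h)

theorem redStepT_iff {v w : Perm (Fin (n + 1))} :
    redStepT v w ↔ (v (Fin.last n) : ℕ) ≠ n ∧ w = topMove v := by
  constructor
  · intro h
    obtain ⟨h₁, h₂⟩ := h (Fin.last n) rfl
    refine ⟨by omega, ?_⟩
    ext j
    rw [h₂ j, topMove_val]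
    simp
  · rintro ⟨h₁, rfl⟩ l hl
    obtain rfl : l = Fin.last n := Fin.ext (by simpa using hl)
    refine ⟨by omega, fun j => ?_⟩
    rw [topMove_val]
    simp

theorem redStepB_iff {v w : Perm (Fin (n + 1))} :
    redStepB v w ↔ (v (Fin.last n) : ℕ) ≠ n ∧ w = botMove v := by
  constructor
  · intro h
    obtain ⟨h₁, h₂⟩ := h (Fin.last n) rfl
    refine ⟨by omega, Equiv.ext fun j => ?_⟩
    obtain ⟨ha, hb, hc⟩ := h₂ j
    rcases lt_trichotomy (j : ℕ) (v⁻¹ (Fin.last n) + 1) with h | h | h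
    · rw [botMove_apply_of_le (by omega)]
      exact ha (Nat.lt_succ_iff.1 h)
    · rw [botMove_apply_of_eq h]
      exact hb h
    · have hj : ((⟨j - 1, by omega⟩ : Fin (n + 1)) : ℕ) + 1 = j := by simp; omega
      rw [botMove_apply_of_lt h hj]
      exact hc h _ hj
  · rintro ⟨h₁, rfl⟩ l hl
    obtain rfl : l = Fin.last n := Fin.ext (by simpa using hl)
    exact ⟨by omega, fun j => ⟨botMove_apply_of_le, botMove_apply_of_eq,
      fun h i hi => botMove_apply_of_lt h hi⟩⟩

/-- Reachability by top and bottom moves. -/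
def MoveReach : Perm (Fin (n + 1)) → Perm (Fin (n + 1)) → Prop :=
  Relation.ReflTransGen fun v w => w = topMove v ∨ w = botMove v

theorem mem_redRauzyClass_iff {v w : Perm (Fin (n + 1))} :
    w ∈ redRauzyClass v ↔ MoveReach v w := by
  constructor
  · refine Relation.ReflTransGen.mono (fun a b h => ?_) v w
    rw [redStepT_iff, redStepB_iff] at h
    exact h.imp And.right And.right
  · intro h
    induction h with
    | refl => exact Relation.ReflTransGen.refl
    | @tail a b _ hab ih =>
      by_cases hl : (a (Fin.last n) : ℕ) = n
      · rw [topMove_eq_self hl, botMove_eq_self hl, or_self] at hab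
        rwa [hab]
      · refine Relation.ReflTransGen.tail ih ?_
        rw [redStepT_iff, redStepB_iff]
        exact hab.imp (⟨hl, ·⟩) (⟨hl, ·⟩)

theorem MoveReach.inv {v w : Perm (Fin (n + 1))} (h : MoveReach v w) :
    MoveReach v⁻¹ w⁻¹ := by
  refine Relation.ReflTransGen.lift (·⁻¹) (fun a b hab => ?_) v w h
  rw [Function.onFun]
  rw [topMove_inv, botMove_inv, inv_inj, inv_inj]
  exact hab.symm

theorem MoveReach.top (v : Perm (Fin (n + 1))) : MoveReach v (topMove v) :=
  Relation.ReflTransGen.single (Or.inl rfl)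

theorem MoveReach.bot (v : Perm (Fin (n + 1))) : MoveReach v (botMove v) :=
  Relation.ReflTransGen.single (Or.inr rfl)

theorem MoveReach.trans {u v w : Perm (Fin (n + 1))} (h : MoveReach u v) (h' : MoveReach v w) :
    MoveReach u w :=
  Relation.ReflTransGen.trans h h'

theorem MoveReach.top_iterate (v : Perm (Fin (n + 1))) (i : ℕ) :
    MoveReach v (topMove^[i] v) := by
  induction i with
  | zero => exact Relation.ReflTransGen.refl
  | succ i ih =>
    rw [Function.iterate_succ_apply']
    exact ih.trans (.top _)

theorem MoveReach.bot_iterate (v : Perm (Fin (n + 1))) (i : ℕ) :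
    MoveReach v (botMove^[i] v) := by
  induction i with
  | zero => exact Relation.ReflTransGen.refl
  | succ i ih =>
    rw [Function.iterate_succ_apply']
    exact ih.trans (.bot _)

theorem topMove_iterate_val {v : Perm (Fin (n + 1))} {k i : ℕ}
    (hv : (v (Fin.last n) : ℕ) + k = n) (hi : i ≤ k) (j : Fin (n + 1)) :
    (topMove^[i] v j : ℕ) = if (v j : ℕ) + k ≤ n then (v j : ℕ)
      else if (v j : ℕ) + i ≤ n then (v j : ℕ) + i else (v j : ℕ) + i - k := by
  induction i generalizing j with
  | zero =>
    have := (v j).isLt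
    simp only [Function.iterate_zero, id_eq]
    split_ifs <;> omega
  | succ i ih =>
    rw [Function.iterate_succ_apply', topMove_val, ih (by omega), ih (by omega)]
    have := (v j).isLt
    split_ifs <;> omega

/-- The last `k` letters carry the values `n - 1, …, n - k` in decreasing order. -/
def HasDescent (k : ℕ) (v : Perm (Fin (n + 1))) : Prop :=
  ∀ j : Fin (n + 1), n < (j : ℕ) + k → (v j : ℕ) + j + k = 2 * n

theorem HasDescent.last {k : ℕ} {v : Perm (Fin (n + 1))} (h : HasDescent k v) (hk : 1 ≤ k) :
    (v (Fin.last n) : ℕ) + k = n := by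
  have := h (Fin.last n) (by simp; omega)
  simp at this
  omega

theorem HasDescent.inv_topMove_iterate {k i : ℕ} {v : Perm (Fin (n + 1))} (h : HasDescent k v)
    (hi : 1 ≤ i) (hik : i < k) (hk : k ≤ n) : HasDescent (k - i) (topMove^[i] v)⁻¹ := by
  intro y hy
  have hyn := y.isLt
  let j : Fin (n + 1) := ⟨2 * n + i - k - y, by omega⟩
  have hj : (j : ℕ) = 2 * n + i - k - y := rfl
  have hvj := h j (by omega)
  have : (topMove^[i] v j : ℕ) = y := by
    rw [topMove_iterate_val (h.last (by omega)) (by omega)]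
    split_ifs <;> omega
  rw [inv_val_eq_iff.2 this]
  omega

/-- Values strictly between `n - k` and `n` sit at the last `k` letters. -/
theorem HasDescent.val_le {k : ℕ} {v : Perm (Fin (n + 1))} (h : HasDescent k v) (hk : k ≤ n)
    {j : Fin (n + 1)} (hj : (j : ℕ) + k ≤ n) (hjn : (v j : ℕ) ≠ n) : (v j : ℕ) + k ≤ n := by
  by_contra hlt
  have := (v j).isLt
  let i : Fin (n + 1) := ⟨2 * n - k - v j, by omega⟩
  have hi : (i : ℕ) = 2 * n - k - v j := rfl
  have hvi := h i (by omega)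
  have : i = j := v.injective (Fin.ext (by omega))
  have := congrArg Fin.val this
  omega

theorem sum_two_pow_sub (k : ℕ) (hk : 1 ≤ k) :
    1 + ∑ i ∈ Finset.Ico 1 k, 2 ^ (k - i - 1) = 2 ^ (k - 1) := by
  induction k, hk using Nat.le_induction with
  | base => simp
  | succ k hk ih =>
    rw [Finset.sum_Ico_eq_sum_range, show k + 1 - 1 = (k - 1) + 1 by omega,
      Finset.sum_range_succ']
    rw [Finset.sum_Ico_eq_sum_range] at ih
    have : ∀ i, k + 1 - (1 + (i + 1)) - 1 = k - (1 + i) - 1 := fun i => by omega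
    simp only [this]
    rw [← add_assoc, ih, show k + 1 - (1 + 0) - 1 = k - 1 by omega, pow_succ]
    omega

/-- The part of the Rauzy diagram hanging from `v` when the last `k` letters form a descent:
a set of `2 ^ (k - 1)` permutations that can only be left through the bottom move at `v`. -/
theorem HasDescent.exists_branch (k : ℕ) : ∀ v : Perm (Fin (n + 1)), HasDescent k v → 1 ≤ k →
    k ≤ n → ∃ S : Finset (Perm (Fin (n + 1))), S.card = 2 ^ (k - 1) ∧ v ∈ S ∧
      (∀ w ∈ S, MoveReach v w) ∧ (∀ w ∈ S, topMove w ∈ S) ∧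
      (∀ w ∈ S, w ≠ v → botMove w ∈ S) ∧
      (∀ w ∈ S, ∀ j : Fin (n + 1), (j : ℕ) + k ≤ n → (v j : ℕ) ≠ n → w j = v j) ∧
      (∀ w ∈ S, ∀ y : Fin (n + 1), (y : ℕ) + k < n → w⁻¹ y = v⁻¹ y) := by
  classical
  induction k using Nat.strong_induction_on with
  | _ k ih =>
  intro v hv hk hkn
  have hlast := hv.last hk
  have hval := fun i (hi : i ≤ k) => topMove_iterate_val hlast hi
  have hbranch : ∀ i : ℕ, ∃ S : Finset (Perm (Fin (n + 1))), i ∈ Finset.Ico 1 k →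
      S.card = 2 ^ (k - i - 1) ∧ topMove^[i] v ∈ S ∧
      (∀ w ∈ S, MoveReach (topMove^[i] v) w) ∧ (∀ w ∈ S, botMove w ∈ S) ∧
      (∀ w ∈ S, w ≠ topMove^[i] v → topMove w ∈ S) ∧
      (∀ w ∈ S, ∀ y : Fin (n + 1), (y : ℕ) + k ≤ n + i → ((topMove^[i] v)⁻¹ y : ℕ) ≠ n →
        w⁻¹ y = (topMove^[i] v)⁻¹ y) ∧
      (∀ w ∈ S, ∀ j : Fin (n + 1), (j : ℕ) + k < n + i → w j = topMove^[i] v j) := by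
    intro i
    by_cases hi : i ∈ Finset.Ico 1 k
    swap
    · exact ⟨∅, fun h => absurd h hi⟩
    have hi' := Finset.mem_Ico.1 hi
    obtain ⟨S, hc, hm, hr, ht, hb, hf, hg⟩ := ih (k - i) (by omega) _
      (hv.inv_topMove_iterate hi'.1 hi'.2 hkn) (by omega) (by omega)
    have mem : ∀ w, w ∈ S.map (Equiv.inv _).toEmbedding ↔ w⁻¹ ∈ S := fun w => by
      rw [Finset.mem_map_equiv]; simp
    refine ⟨S.map (Equiv.inv _).toEmbedding, fun _ => ⟨by rw [Finset.card_map, hc],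
      (mem _).2 hm, fun w hw => ?_, fun w hw => ?_, fun w hw hne => ?_, fun w hw y hy hyn => ?_,
      fun w hw j hj => ?_⟩⟩ <;> rw [mem] at hw
    · simpa using (hr _ hw).inv
    · rw [mem, ← topMove_inv]; exact ht _ hw
    · rw [mem, ← botMove_inv]; exact hb _ hw (by simpa using hne)
    · exact hf _ hw y (by omega) hyn
    · simpa using hg _ hw j (by omega)
  choose S hS using hbranch
  have hp : ((v⁻¹ (Fin.last n) : Fin (n + 1)) : ℕ) + k ≤ n := by
    by_contra h
    have := hv (v⁻¹ (Fin.last n)) (by omega)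
    rw [apply_inv_apply, Fin.val_last] at this
    omega
  have hlabel : ∀ i ∈ Finset.Ico 1 k, ∀ w ∈ S i, (w (v⁻¹ (Fin.last n)) : ℕ) + k = n + i := by
    intro i hi w hw
    have hi' := Finset.mem_Ico.1 hi
    obtain ⟨-, -, -, -, -, -, hg⟩ := hS i hi
    rw [hg w hw _ (by omega), hval i (by omega)]
    simp only [apply_inv_apply, Fin.val_last]
    split_ifs <;> omega
  have hloop : topMove^[k] v = v := by
    ext j
    have := (v j).isLt
    rw [hval k le_rfl]
    split_ifs <;> omega
  have hmem : ∀ i, 1 ≤ i → i ≤ k → topMove^[i] v ∈ insert v ((Finset.Ico 1 k).biUnion S) := by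
    intro i hi hik
    rcases hik.eq_or_lt with rfl | hlt
    · rw [hloop]; exact Finset.mem_insert_self _ _
    · have hi' := Finset.mem_Ico.2 ⟨hi, hlt⟩
      exact Finset.mem_insert_of_mem (Finset.mem_biUnion.2 ⟨i, hi', (hS i hi').2.1⟩)
  refine ⟨insert v ((Finset.Ico 1 k).biUnion S), ?_, Finset.mem_insert_self _ _, ?_, ?_, ?_, ?_, ?_⟩
  · rw [Finset.card_insert_of_notMem, Finset.card_biUnion,
      Finset.sum_congr rfl fun i hi => (hS i hi).1, add_comm, sum_two_pow_sub k hk]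
    · intro i hi i' hi' hne
      rw [Function.onFun, Finset.disjoint_left]
      intro w hw hw'
      have := hlabel i hi w hw
      have := hlabel i' hi' w hw'
      omega
    · intro h
      obtain ⟨i, hi, hw⟩ := Finset.mem_biUnion.1 h
      have := hlabel i hi v hw
      have := Finset.mem_Ico.1 hi
      rw [apply_inv_apply, Fin.val_last] at *
      omega
  · intro w hw
    rcases Finset.mem_insert.1 hw with rfl | hw
    · exact Relation.ReflTransGen.refl
    · obtain ⟨i, hi, hw⟩ := Finset.mem_biUnion.1 hw
      exact (MoveReach.top_iterate v i).trans ((hS i hi).2.2.1 w hw)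
  · intro w hw
    rcases Finset.mem_insert.1 hw with rfl | hw
    · exact hmem 1 le_rfl hk
    · obtain ⟨i, hi, hw⟩ := Finset.mem_biUnion.1 hw
      have hi' := Finset.mem_Ico.1 hi
      by_cases hne : w = topMove^[i] v
      · rw [hne, ← Function.iterate_succ_apply' topMove]
        exact hmem (i + 1) (by omega) (by omega)
      · exact Finset.mem_insert_of_mem
          (Finset.mem_biUnion.2 ⟨i, hi, (hS i hi).2.2.2.2.1 w hw hne⟩)
  · intro w hw hne
    obtain ⟨i, hi, hw⟩ := Finset.mem_biUnion.1 ((Finset.mem_insert.1 hw).resolve_left hne)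
    exact Finset.mem_insert_of_mem (Finset.mem_biUnion.2 ⟨i, hi, (hS i hi).2.2.2.1 w hw⟩)
  · intro w hw j hj hjn
    rcases Finset.mem_insert.1 hw with rfl | hw
    · rfl
    · obtain ⟨i, hi, hw⟩ := Finset.mem_biUnion.1 hw
      have hi' := Finset.mem_Ico.1 hi
      obtain ⟨-, -, -, -, -, -, hg⟩ := hS i hi
      rw [hg w hw j (by omega)]
      apply Fin.ext
      rw [hval i (by omega), if_pos (hv.val_le hkn hj hjn)]
  · intro w hw y hy
    rcases Finset.mem_insert.1 hw with rfl | hw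
    · rfl
    · obtain ⟨i, hi, hw⟩ := Finset.mem_biUnion.1 hw
      have hi' := Finset.mem_Ico.1 hi
      obtain ⟨-, -, -, -, -, hf, -⟩ := hS i hi
      have hy' : (topMove^[i] v)⁻¹ y = v⁻¹ y := by
        rw [Equiv.Perm.inv_eq_iff_eq]
        apply Fin.ext
        rw [hval i (by omega)]
        simp only [apply_inv_apply]
        rw [if_pos (by omega)]
      rw [hf w hw y (by omega), hy']
      rw [hy']
      intro h
      have := (inv_val_eq_iff (j := Fin.last n)).1 (by simpa using h)
      omega

theorem botMove_val {v : Perm (Fin (n + 1))} {p : Fin (n + 1)} (hp : (v p : ℕ) = n)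
    (f : ℕ → ℕ) (hf : ∀ j : Fin (n + 1), (v j : ℕ) = f j) (j : Fin (n + 1)) :
    (botMove v j : ℕ) = if (j : ℕ) ≤ p then f j else if (j : ℕ) = p + 1 then f n
      else f (j - 1) := by
  have hp' : (v⁻¹ (Fin.last n) : ℕ) = p := inv_val_eq_iff.2 (by simpa using hp)
  split_ifs with h h'
  · rw [botMove_apply_of_le (by omega), hf]
  · rw [botMove_apply_of_eq (by omega), hf, Fin.val_last]
  · have hj : ((⟨j - 1, by omega⟩ : Fin (n + 1)) : ℕ) + 1 = j := by simp; omega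
    rw [botMove_apply_of_lt (by omega) hj, hf]

/-- The central permutation of the class, `σ_n` in zero-based notation. -/
def IsCenter (v : Perm (Fin (n + 1))) : Prop :=
  ∀ j : Fin (n + 1), (v j : ℕ) = if (j : ℕ) = 0 then n else if (j : ℕ) = n then 0
    else if (j : ℕ) + 1 = n then n - 1 else n - 1 - j

/-- The image of the center by the top move. -/
def IsFirstTop (v : Perm (Fin (n + 1))) : Prop :=
  ∀ j : Fin (n + 1), (v j : ℕ) = if (j : ℕ) = 0 then 1 else if (j : ℕ) = n then 0
    else if (j : ℕ) + 1 = n then n else n - j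

/-- Values of the core permutation sending `0` to `a` and `b` to `0`. -/
def coreVal (n a b j : ℕ) : ℕ :=
  if j = 0 then a else if j + 2 ≤ a then a - 1 - j else if j + 1 = a then n
    else if j < b then (if j + 1 = b then a - 1 else a + b - 1 - j)
    else if j = b then 0 else if a = b ∧ j = n then a - 1 else n + b - j

/-- The core permutation sending `0` to `a` and `b` to `0`. -/
def IsCore (a b : ℕ) (v : Perm (Fin (n + 1))) : Prop :=
  ∀ j : Fin (n + 1), (v j : ℕ) = coreVal n a b j

theorem IsCenter.unique {v w : Perm (Fin (n + 1))} (hv : IsCenter v) (hw : IsCenter w) :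
    v = w := by
  ext j
  rw [hv j, hw j]

theorem IsCore.unique {a b : ℕ} {v w : Perm (Fin (n + 1))} (hv : IsCore a b v)
    (hw : IsCore a b w) : v = w := by
  ext j
  rw [hv j, hw j]

theorem IsCenter.inv_eq {v : Perm (Fin (n + 1))} (h : IsCenter v) (hn : 2 ≤ n) : v⁻¹ = v := by
  ext j
  rw [inv_val_eq_iff]
  have h₁ := h j
  have h₂ := h (v j)
  have := j.isLt
  split_ifs at h₁ h₂ <;> omega

theorem IsCore.inv_eq {a : ℕ} {v : Perm (Fin (n + 1))} (h : IsCore a a v) (ha : 2 ≤ a)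
    (han : a < n) : v⁻¹ = v := by
  ext j
  rw [inv_val_eq_iff]
  have h₁ := h j
  have h₂ := h (v j)
  have := j.isLt
  unfold coreVal at h₁ h₂
  split_ifs at h₁ h₂ <;> omega

theorem IsCenter.isFirstTop_topMove {v : Perm (Fin (n + 1))} (h : IsCenter v) (hn : 2 ≤ n) :
    IsFirstTop (topMove v) := by
  intro j
  have h₁ := h j
  have h₂ := h (Fin.last n)
  have := j.isLt
  rw [topMove_val]
  rw [Fin.val_last] at h₂
  rw [if_neg (by omega), if_pos rfl] at h₂
  split_ifs at h₁ ⊢ <;> omega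

theorem IsFirstTop.botMove_eq {v : Perm (Fin (n + 1))} (h : IsFirstTop v) (hn : 2 ≤ n) :
    botMove v = v := by
  have hp : (v ⟨n - 1, by omega⟩ : ℕ) = n := by
    rw [h]
    simp only
    split_ifs <;> omega
  ext j
  have := j.isLt
  rw [botMove_val hp (fun j => if j = 0 then 1 else if j = n then 0
    else if j + 1 = n then n else n - j) h, h j]
  simp only
  split_ifs <;> omega

theorem IsFirstTop.isCenter_topMove {v : Perm (Fin (n + 1))} (h : IsFirstTop v) (hn : n = 2) :
    IsCenter (topMove v) := by
  intro j
  have h₁ := h j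
  have h₂ := h (Fin.last n)
  have := j.isLt
  rw [topMove_val]
  rw [Fin.val_last] at h₂
  rw [if_neg (by omega), if_pos rfl] at h₂
  split_ifs at h₁ ⊢ <;> omega

theorem IsFirstTop.isCore_topMove {v : Perm (Fin (n + 1))} (h : IsFirstTop v) (hn : 3 ≤ n) :
    IsCore 2 n (topMove v) := by
  intro j
  have h₁ := h j
  have h₂ := h (Fin.last n)
  have := j.isLt
  rw [topMove_val]
  rw [Fin.val_last] at h₂
  rw [if_neg (by omega), if_pos rfl] at h₂
  unfold coreVal
  split_ifs at h₁ ⊢ <;> omega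

theorem IsCore.last_eq_zero {a : ℕ} {v : Perm (Fin (n + 1))} (h : IsCore a n v) (ha : 1 ≤ a)
    (han : a < n) : (v (Fin.last n) : ℕ) = 0 := by
  rw [h, Fin.val_last]
  unfold coreVal
  split_ifs <;> omega

theorem IsCore.isCore_topMove {a : ℕ} {v : Perm (Fin (n + 1))} (h : IsCore a n v) (ha : 2 ≤ a)
    (han : a + 1 < n) : IsCore (a + 1) n (topMove v) := by
  intro j
  have h₁ := h j
  have h₂ := h.last_eq_zero (by omega) (by omega)
  have := j.isLt
  rw [topMove_val]
  unfold coreVal at *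
  split_ifs at h₁ ⊢ <;> omega

theorem IsCore.isCenter_topMove {a : ℕ} {v : Perm (Fin (n + 1))} (h : IsCore a n v)
    (ha : 2 ≤ a) (han : a + 1 = n) : IsCenter (topMove v) := by
  intro j
  have h₁ := h j
  have h₂ := h.last_eq_zero (by omega) (by omega)
  have := j.isLt
  rw [topMove_val]
  unfold coreVal at *
  split_ifs at h₁ ⊢ <;> omega

theorem IsCore.apply_pred {a b : ℕ} {v : Perm (Fin (n + 1))} (h : IsCore a b v) (ha : 2 ≤ a)
    (han : a < n) : (v ⟨a - 1, by omega⟩ : ℕ) = n := by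
  rw [h]
  unfold coreVal
  simp only
  split_ifs <;> omega

theorem IsCore.isCore_botMove {a b : ℕ} {v : Perm (Fin (n + 1))} (h : IsCore a b v) (ha : 2 ≤ a)
    (hab : a ≤ b) (hbn : b < n) : IsCore a (b + 1) (botMove v) := by
  intro j
  have := j.isLt
  rw [botMove_val (h.apply_pred ha (by omega)) _ h]
  grind (splits := 14) [coreVal]

theorem IsCore.isCore_botMove_of_eq {a : ℕ} {v : Perm (Fin (n + 1))} (h : IsCore a n v) (ha : 2 ≤ a)
    (han : a < n) : IsCore a a (botMove v) := by
  intro j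
  have := j.isLt
  rw [botMove_val (h.apply_pred ha (by omega)) _ h]
  grind (splits := 14) [coreVal]

theorem IsCore.isCore_botMove_iterate {a i : ℕ} {v : Perm (Fin (n + 1))} (h : IsCore a a v)
    (ha : 2 ≤ a) (hi : a + i ≤ n) : IsCore a (a + i) (botMove^[i] v) := by
  induction i with
  | zero => exact h
  | succ i ih =>
    rw [Function.iterate_succ_apply']
    exact (ih (by omega)).isCore_botMove ha (by omega) (by omega)

theorem IsCore.hasDescent {a b : ℕ} {v : Perm (Fin (n + 1))} (h : IsCore a b v) (ha : 2 ≤ a)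
    (hab : a < b) (hbn : b < n) : HasDescent (n - b) v := by
  intro j hj
  have := j.isLt
  rw [h]
  unfold coreVal
  split_ifs <;> omega

theorem IsCore.apply_zero {a b : ℕ} {v : Perm (Fin (n + 1))} (h : IsCore a b v) :
    (v 0 : ℕ) = a := by
  rw [h]
  simp [coreVal]

theorem IsCore.inv_zero {a b : ℕ} {v : Perm (Fin (n + 1))} (h : IsCore a b v) (ha : 2 ≤ a)
    (hab : a ≤ b) (hbn : b ≤ n) : (v⁻¹ 0 : ℕ) = b := by
  refine (inv_val_eq_iff (j := ⟨b, by omega⟩)).2 ?_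
  rw [h, Fin.val_zero]
  unfold coreVal
  simp only
  split_ifs <;> omega

/-- The permutations of the class sending `0` to `a` and something larger than `a` to `0`. -/
theorem IsCore.exists_wing {a : ℕ} {y : Perm (Fin (n + 1))} (hy : IsCore a n y) (ha : 2 ≤ a)
    (han : a < n) : ∃ S : Finset (Perm (Fin (n + 1))), S.card = 2 ^ (n - a - 1) ∧ y ∈ S ∧
      (∀ w ∈ S, MoveReach y w) ∧ (∀ w ∈ S, (w 0 : ℕ) = a ∧ a < (w⁻¹ 0 : ℕ)) ∧
      (∀ w ∈ S, w ≠ y → topMove w ∈ S) ∧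
      (∀ w ∈ S, botMove w ∈ S ∨ botMove w = botMove y) ∧
      botMove (botMove y) ∈ S := by
  classical
  set x := botMove y with hx
  have hxc : IsCore a a x := hy.isCore_botMove_of_eq ha han
  have hcore := fun i (hi : a + i ≤ n) => hxc.isCore_botMove_iterate ha hi
  have hbranch : ∀ i : ℕ, ∃ S : Finset (Perm (Fin (n + 1))), i ∈ Finset.Ico 1 (n - a) →
      S.card = 2 ^ (n - a - i - 1) ∧ botMove^[i] x ∈ S ∧
      (∀ w ∈ S, MoveReach (botMove^[i] x) w) ∧ (∀ w ∈ S, topMove w ∈ S) ∧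
      (∀ w ∈ S, w ≠ botMove^[i] x → botMove w ∈ S) ∧
      (∀ w ∈ S, (w 0 : ℕ) = a ∧ (w⁻¹ 0 : ℕ) = a + i) := by
    intro i
    by_cases hi : i ∈ Finset.Ico 1 (n - a)
    swap
    · exact ⟨∅, fun h => absurd h hi⟩
    have hi' := Finset.mem_Ico.1 hi
    have hc := hcore i (by omega)
    obtain ⟨S, hcard, hm, hr, ht, hb, hf, -⟩ := HasDescent.exists_branch _ _
      (hc.hasDescent ha (by omega) (by omega)) (by omega) (by omega)
    refine ⟨S, fun _ => ⟨by rw [hcard]; congr 1; omega, hm, hr, ht, hb, fun w hw => ⟨?_, ?_⟩⟩⟩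
    · rw [hf w hw 0 (by simp), hc.apply_zero]
      rw [hc.apply_zero]
      omega
    · have h0 := (inv_val_eq_iff (j := ⟨a + i, by omega⟩)).1
        (hc.inv_zero ha (by omega) (by omega))
      refine (inv_val_eq_iff (j := ⟨a + i, by omega⟩)).2 ?_
      rw [hf w hw _ (by simp; omega), h0]
      rw [h0, Fin.val_zero]
      omega
  choose S hS using hbranch
  have hloop : botMove^[n - a] x = y := by
    have := hcore (n - a) (by omega)
    rw [show a + (n - a) = n by omega] at this
    exact this.unique hy
  have hmem : ∀ i, 1 ≤ i → i ≤ n - a →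
      botMove^[i] x ∈ insert y ((Finset.Ico 1 (n - a)).biUnion S) := by
    intro i hi hik
    rcases hik.eq_or_lt with rfl | hlt
    · rw [hloop]; exact Finset.mem_insert_self _ _
    · have hi' := Finset.mem_Ico.2 ⟨hi, hlt⟩
      exact Finset.mem_insert_of_mem (Finset.mem_biUnion.2 ⟨i, hi', (hS i hi').2.1⟩)
  have hy0 := hy.inv_zero ha han.le le_rfl
  refine ⟨insert y ((Finset.Ico 1 (n - a)).biUnion S), ?_, Finset.mem_insert_self _ _,
    ?_, ?_, ?_, ?_, hmem 1 le_rfl (by omega)⟩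
  · rw [Finset.card_insert_of_notMem, Finset.card_biUnion,
      Finset.sum_congr rfl fun i hi => (hS i hi).1, add_comm, sum_two_pow_sub _ (by omega)]
    · intro i hi i' hi' hne
      rw [Function.onFun, Finset.disjoint_left]
      intro w hw hw'
      have := ((hS i hi).2.2.2.2.2 w hw).2
      have := ((hS i' hi').2.2.2.2.2 w hw').2
      omega
    · intro h
      obtain ⟨i, hi, hw⟩ := Finset.mem_biUnion.1 h
      have := ((hS i hi).2.2.2.2.2 y hw).2
      have := Finset.mem_Ico.1 hi
      omega
  · intro w hw
    rcases Finset.mem_insert.1 hw with rfl | hw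
    · exact Relation.ReflTransGen.refl
    · obtain ⟨i, hi, hw⟩ := Finset.mem_biUnion.1 hw
      exact ((MoveReach.bot y).trans (MoveReach.bot_iterate x i)).trans ((hS i hi).2.2.1 w hw)
  · intro w hw
    rcases Finset.mem_insert.1 hw with rfl | hw
    · exact ⟨hy.apply_zero, by omega⟩
    · obtain ⟨i, hi, hw⟩ := Finset.mem_biUnion.1 hw
      have hi' := Finset.mem_Ico.1 hi
      have := (hS i hi).2.2.2.2.2 w hw
      exact ⟨this.1, by omega⟩
  · intro w hw hne
    obtain ⟨i, hi, hw⟩ := Finset.mem_biUnion.1 ((Finset.mem_insert.1 hw).resolve_left hne)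
    exact Finset.mem_insert_of_mem (Finset.mem_biUnion.2 ⟨i, hi, (hS i hi).2.2.2.1 w hw⟩)
  · intro w hw
    rcases Finset.mem_insert.1 hw with rfl | hw
    · exact Or.inr rfl
    · obtain ⟨i, hi, hw⟩ := Finset.mem_biUnion.1 hw
      have hi' := Finset.mem_Ico.1 hi
      left
      by_cases hne : w = botMove^[i] x
      · rw [hne, ← Function.iterate_succ_apply' botMove]
        exact hmem (i + 1) (by omega) (by omega)
      · exact Finset.mem_insert_of_mem
          (Finset.mem_biUnion.2 ⟨i, hi, (hS i hi).2.2.2.2.1 w hw hne⟩)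

theorem IsCenter.isCore_topMove_iterate {v : Perm (Fin (n + 1))} (h : IsCenter v) {a : ℕ}
    (ha : 2 ≤ a) (han : a < n) : IsCore a n (topMove^[a] v) := by
  induction a, ha using Nat.le_induction with
  | base => exact (h.isFirstTop_topMove (by omega)).isCore_topMove (by omega)
  | succ a ha ih =>
    rw [Function.iterate_succ_apply']
    exact (ih (by omega)).isCore_topMove ha han

/-- The permutations of the class with `v 0 < v⁻¹ 0`. -/
theorem IsCenter.exists_upper {σ : Perm (Fin (n + 1))} (h : IsCenter σ) (hn : 2 ≤ n) :
    ∃ U : Finset (Perm (Fin (n + 1))), U.card = 2 ^ (n - 2) ∧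
      (∀ w ∈ U, MoveReach σ w) ∧ (∀ w ∈ U, (w 0 : ℕ) < w⁻¹ 0) ∧ topMove σ ∈ U ∧
      (∀ w ∈ U, topMove w ∈ U ∨ topMove w = σ) ∧
      (∀ w ∈ U, botMove w ∈ U ∨
        ∃ a, 2 ≤ a ∧ a < n ∧ botMove w = botMove (topMove^[a] σ)) ∧
      (∀ a, 2 ≤ a → a < n → botMove (botMove (topMove^[a] σ)) ∈ U) := by
  classical
  have hwing : ∀ i : ℕ, ∃ S : Finset (Perm (Fin (n + 1))), i ∈ Finset.Ico 1 (n - 1) →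
      S.card = 2 ^ (n - 1 - i - 1) ∧ topMove^[i + 1] σ ∈ S ∧
      (∀ w ∈ S, MoveReach (topMove^[i + 1] σ) w) ∧
      (∀ w ∈ S, (w 0 : ℕ) = i + 1 ∧ i + 1 < (w⁻¹ 0 : ℕ)) ∧
      (∀ w ∈ S, w ≠ topMove^[i + 1] σ → topMove w ∈ S) ∧
      (∀ w ∈ S, botMove w ∈ S ∨
        botMove w = botMove (topMove^[i + 1] σ)) ∧
      botMove (botMove (topMove^[i + 1] σ)) ∈ S := by
    intro i
    by_cases hi : i ∈ Finset.Ico 1 (n - 1)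
    swap
    · exact ⟨∅, fun h => absurd h hi⟩
    have hi' := Finset.mem_Ico.1 hi
    obtain ⟨S, hcard, hS⟩ := (h.isCore_topMove_iterate (a := i + 1) (by omega) (by omega)).exists_wing
      (by omega) (by omega)
    exact ⟨S, fun _ => ⟨by rw [hcard]; congr 1; omega, hS⟩⟩
  choose S hS using hwing
  have hfirst := h.isFirstTop_topMove hn
  have hf0 : (topMove σ 0 : ℕ) = 1 := by rw [hfirst]; simp
  have hf0' : ((topMove σ)⁻¹ 0 : ℕ) = n := by
    refine (inv_val_eq_iff (j := Fin.last n)).2 ?_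
    rw [hfirst, Fin.val_last, if_neg (by omega), if_pos rfl, Fin.val_zero]
  set U := insert (topMove σ) ((Finset.Ico 1 (n - 1)).biUnion S) with hU
  have hmemU : ∀ i ∈ Finset.Ico 1 (n - 1), ∀ w ∈ S i, w ∈ U := fun i hi w hw =>
    Finset.mem_insert_of_mem (Finset.mem_biUnion.2 ⟨i, hi, hw⟩)
  have hnext : ∀ a, 1 ≤ a → a < n → topMove (topMove^[a] σ) ∈ U ∨
      topMove (topMove^[a] σ) = σ := by
    intro a ha han
    rcases Nat.lt_or_ge (a + 1) n with hlt | hge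
    · rw [← Function.iterate_succ_apply' topMove]
      have hi := Finset.mem_Ico.2 ⟨ha, show a < n - 1 by omega⟩
      exact Or.inl (hmemU a hi _ (hS a hi).2.1)
    · right
      rcases ha.eq_or_lt with rfl | ha
      · exact (hfirst.isCenter_topMove (by omega)).unique h
      · exact ((h.isCore_topMove_iterate ha han).isCenter_topMove ha (by omega)).unique h
  refine ⟨U, ?_, ?_, ?_, Finset.mem_insert_self _ _, ?_, ?_, ?_⟩
  · rw [hU, Finset.card_insert_of_notMem, Finset.card_biUnion,
      Finset.sum_congr rfl fun i hi => (hS i hi).1, add_comm, sum_two_pow_sub _ (by omega)]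
    · rfl
    · intro i hi i' hi' hne
      rw [Function.onFun, Finset.disjoint_left]
      intro w hw hw'
      have := ((hS i hi).2.2.2.1 w hw).1
      have := ((hS i' hi').2.2.2.1 w hw').1
      omega
    · intro h
      obtain ⟨i, hi, hw⟩ := Finset.mem_biUnion.1 h
      have := ((hS i hi).2.2.2.1 _ hw).1
      have := Finset.mem_Ico.1 hi
      omega
  · intro w hw
    rcases Finset.mem_insert.1 hw with rfl | hw
    · exact .top σ
    · obtain ⟨i, hi, hw⟩ := Finset.mem_biUnion.1 hw
      exact (MoveReach.top_iterate σ (i + 1)).trans ((hS i hi).2.2.1 w hw)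
  · intro w hw
    rcases Finset.mem_insert.1 hw with rfl | hw
    · omega
    · obtain ⟨i, hi, hw⟩ := Finset.mem_biUnion.1 hw
      have := (hS i hi).2.2.2.1 w hw
      omega
  · intro w hw
    rcases Finset.mem_insert.1 hw with rfl | hw
    · exact hnext 1 le_rfl (by omega)
    · obtain ⟨i, hi, hw⟩ := Finset.mem_biUnion.1 hw
      have hi' := Finset.mem_Ico.1 hi
      by_cases hne : w = topMove^[i + 1] σ
      · rw [hne]
        exact hnext (i + 1) (by omega) (by omega)
      · exact Or.inl (hmemU i hi _ ((hS i hi).2.2.2.2.1 w hw hne))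
  · intro w hw
    rcases Finset.mem_insert.1 hw with rfl | hw
    · left
      rw [hfirst.botMove_eq hn]
      exact Finset.mem_insert_self _ _
    · obtain ⟨i, hi, hw⟩ := Finset.mem_biUnion.1 hw
      have hi' := Finset.mem_Ico.1 hi
      rcases (hS i hi).2.2.2.2.2.1 w hw with hb | hb
      · exact Or.inl (hmemU i hi _ hb)
      · exact Or.inr ⟨i + 1, by omega, by omega, hb⟩
  · intro a ha han
    obtain ⟨i, rfl⟩ : ∃ i, a = i + 1 := ⟨a - 1, by omega⟩
    have hi := Finset.mem_Ico.2 ⟨show 1 ≤ i by omega, show i < n - 1 by omega⟩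
    exact hmemU i hi _ (hS i hi).2.2.2.2.2.2

/-- The Rauzy class of the center, split according to the order of `v 0` and `v⁻¹ 0`. -/
theorem IsCenter.exists_finset {σ : Perm (Fin (n + 1))} (h : IsCenter σ) (hn : 2 ≤ n) :
    ∃ G : Finset (Perm (Fin (n + 1))), G.card = 2 ^ (n - 1) - 1 + n ∧
      ∀ w, MoveReach σ w ↔ w ∈ G := by
  classical
  obtain ⟨U, hcard, hr, hlt, hσ, ht, hb, hcore⟩ := h.exists_upper hn
  set diag : ℕ → Perm (Fin (n + 1)) := fun a => botMove (topMove^[a] σ) with hdiag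
  have hd : ∀ a, 2 ≤ a → a < n → IsCore a a (diag a) := fun a ha han =>
    (h.isCore_topMove_iterate ha han).isCore_botMove_of_eq ha han
  set D := insert σ ((Finset.Ico 2 n).image diag) with hD
  have hDmem : ∀ a, 2 ≤ a → a < n → diag a ∈ D := fun a ha han =>
    Finset.mem_insert_of_mem (Finset.mem_image_of_mem _ (Finset.mem_Ico.2 ⟨ha, han⟩))
  have hσ0 : (σ 0 : ℕ) = n := by rw [h]; simp
  have hDinv : ∀ w ∈ D, w⁻¹ = w := by
    intro w hw
    rcases Finset.mem_insert.1 hw with rfl | hw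
    · exact h.inv_eq hn
    · obtain ⟨a, ha, rfl⟩ := Finset.mem_image.1 hw
      obtain ⟨ha, han⟩ := Finset.mem_Ico.1 ha
      exact (hd a ha han).inv_eq ha han
  have hDcard : D.card = n - 1 := by
    rw [hD, Finset.card_insert_of_notMem, Finset.card_image_of_injOn, Nat.card_Ico]
    · omega
    · intro a ha a' ha' heq
      obtain ⟨ha, han⟩ := Finset.mem_Ico.1 ha
      obtain ⟨ha', han'⟩ := Finset.mem_Ico.1 ha'
      have h₁ := (hd a ha han).apply_zero
      have h₂ := (hd a' ha' han').apply_zero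
      rw [heq] at h₁
      omega
    · intro hmem
      obtain ⟨a, ha, heq⟩ := Finset.mem_image.1 hmem
      obtain ⟨ha, han⟩ := Finset.mem_Ico.1 ha
      have h₁ := (hd a ha han).apply_zero
      rw [heq] at h₁
      omega
  set V := U.map (Equiv.inv (Perm (Fin (n + 1)))).toEmbedding with hV
  have hVmem : ∀ w, w ∈ V ↔ w⁻¹ ∈ U := fun w => by
    rw [hV, Finset.mem_map_equiv]; simp
  have hGinv : ∀ w ∈ D ∪ U ∪ V, w⁻¹ ∈ D ∪ U ∪ V := by
    intro w hw
    simp only [Finset.mem_union, hVmem, inv_inv] at hw ⊢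
    rcases hw with (hw | hw) | hw
    · rw [hDinv w hw]; exact Or.inl (Or.inl hw)
    · exact Or.inr hw
    · exact Or.inl (Or.inr hw)
  have hGtop : ∀ w ∈ D ∪ U ∪ V, topMove w ∈ D ∪ U ∪ V := by
    intro w hw
    simp only [Finset.mem_union, hVmem] at hw ⊢
    rcases hw with (hw | hw) | hw
    · rcases Finset.mem_insert.1 hw with rfl | hw'
      · exact Or.inl (Or.inr hσ)
      · right
        rw [← botMove_inv, hDinv w hw]
        obtain ⟨a, ha, rfl⟩ := Finset.mem_image.1 hw'
        obtain ⟨ha, han⟩ := Finset.mem_Ico.1 ha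
        exact hcore a ha han
    · left
      rcases ht w hw with hw | hw
      · exact Or.inr hw
      · rw [hw]; exact Or.inl (Finset.mem_insert_self _ _)
    · rw [← botMove_inv]
      rcases hb _ hw with hw | ⟨a, ha, han, hw⟩
      · exact Or.inr hw
      · left; left
        have hmem := hDmem a ha han
        rw [botMove_inv, inv_eq_iff_eq_inv] at hw
        rw [hw]
        exact (hDinv _ hmem).symm ▸ hmem
  have hGbot : ∀ w ∈ D ∪ U ∪ V, botMove w ∈ D ∪ U ∪ V := fun w hw =>
    hGinv _ (hGtop _ (hGinv _ hw))
  refine ⟨D ∪ U ∪ V, ?_, fun w => ⟨fun hw => ?_, fun hw => ?_⟩⟩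
  · rw [Finset.card_union_of_disjoint, Finset.card_union_of_disjoint, hDcard, hV,
      Finset.card_map, hcard]
    · obtain ⟨m, rfl⟩ : ∃ m, n = m + 2 := ⟨n - 2, by omega⟩
      have : 1 ≤ 2 ^ m := Nat.one_le_two_pow
      simp only [Nat.add_sub_cancel, show m + 2 - 1 = m + 1 by omega, pow_succ]
      omega
    · rw [Finset.disjoint_left]
      intro w hw hw'
      have := hlt w hw'
      rw [hDinv w hw] at this
      omega
    · rw [Finset.disjoint_left]
      intro w hw hw'
      have h' := hlt _ ((hVmem w).1 hw')
      rw [inv_inv] at h'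
      rcases Finset.mem_union.1 hw with hw | hw
      · rw [hDinv w hw] at h'
        omega
      · have := hlt w hw
        omega
  · induction hw with
    | refl => simp [hD]
    | tail _ hab ih =>
      rcases hab with rfl | rfl
      · exact hGtop _ ih
      · exact hGbot _ ih
  · simp only [Finset.mem_union, hVmem] at hw
    rcases hw with (hw | hw) | hw
    · rcases Finset.mem_insert.1 hw with rfl | hw
      · exact Relation.ReflTransGen.refl
      · obtain ⟨a, ha, rfl⟩ := Finset.mem_image.1 hw
        exact (MoveReach.top_iterate σ a).trans (.bot _)
    · exact hr w hw
    · simpa [h.inv_eq hn] using (hr _ hw).inv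

/-- For every `n ≥ 2`, the permutation `σ_n` of `{1,…,n+1}` given (in 1-based notation)
by `σ_n(1) = n+1`, `σ_n(j) = n+1-j` for `2 ≤ j ≤ n-1`, `σ_n(n) = n`, `σ_n(n+1) = 1`
(here encoded 0-based on `Fin (n+1)`) has a reduced Rauzy class that is finite of
cardinality `2 ^ (n-1) - 1 + n`. -/
theorem redRauzyClass_sigma_card (n : ℕ) (hn : 2 ≤ n) (σ : Equiv.Perm (Fin (n + 1)))
    (hσ : ∀ i : Fin (n + 1),
      ((i : ℕ) = 0 → (σ i : ℕ) = n) ∧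
      (1 ≤ (i : ℕ) ∧ (i : ℕ) ≤ n - 2 → (σ i : ℕ) = n - 1 - (i : ℕ)) ∧
      ((i : ℕ) = n - 1 → (σ i : ℕ) = n - 1) ∧
      ((i : ℕ) = n → (σ i : ℕ) = 0)) :
    (redRauzyClass σ).Finite ∧ (redRauzyClass σ).ncard = 2 ^ (n - 1) - 1 + n := by
  have h : IsCenter σ := by
    intro j
    obtain ⟨h₀, h₁, h₂, h₃⟩ := hσ j
    have := j.isLt
    split_ifs <;> omega
  obtain ⟨G, hcard, hG⟩ := h.exists_finset hn
  have hclass : redRauzyClass σ = ↑G := by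
    ext w
    rw [mem_redRauzyClass_iff, hG, Finset.mem_coe]
  rw [hclass]
  exact ⟨G.finite_toSet, by rw [Set.ncard_coe_finset, hcard]⟩
end

section
/- Let σ be the permutation of {1,…,9} given in one-line notation by (9, 1, 4, 3, 2, 5, 8, 7, 6), i.e. σ(1)=9, σ(2)=1, σ(3)=4, σ(4)=3, σ(5)=2, σ(6)=5, σ(7)=8, σ(8)=7, σ(9)=6. Then the reduced Rauzy class R(σ) is finite and has cardinality 1255. -/
/-! ### Rauzy moves as multiplication by cycles -/

/-- The cycle fixing `0, …, k` and sending `last ↦ k + 1` and `x ↦ x + 1` for `k < x < last`. -/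
def rauzyCycle {n : ℕ} (k : Fin (n + 1)) : Equiv.Perm (Fin (n + 1)) where
  toFun x := ⟨if (x : ℕ) ≤ k then x else if (x : ℕ) = n then k + 1 else x + 1, by
    split_ifs <;> omega⟩
  invFun x := ⟨if (x : ℕ) ≤ k then x else if (x : ℕ) = k + 1 then n else x - 1, by
    split_ifs <;> omega⟩
  left_inv x := by
    ext
    dsimp only
    split_ifs <;> omega
  right_inv x := by
    ext
    dsimp only
    split_ifs <;> omega

theorem rauzyCycle_val {n : ℕ} (k x : Fin (n + 1)) :
    (rauzyCycle k x : ℕ) =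
      if (x : ℕ) ≤ k then (x : ℕ) else if (x : ℕ) = n then (k : ℕ) + 1 else (x : ℕ) + 1 := rfl

theorem rauzyCycle_symm_val {n : ℕ} (k x : Fin (n + 1)) :
    ((rauzyCycle k).symm x : ℕ) =
      if (x : ℕ) ≤ k then (x : ℕ) else if (x : ℕ) = k + 1 then n else (x : ℕ) - 1 := rfl

theorem forall_val_add_one_eq_iff {n : ℕ} {P : Fin (n + 1) → Prop} :
    (∀ last : Fin (n + 1), (last : ℕ) + 1 = n + 1 → P last) ↔ P (Fin.last n) := by
  refine ⟨fun h => h _ rfl, fun h last hlast => ?_⟩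
  rwa [show last = Fin.last n from Fin.ext (Nat.succ.inj hlast)]

theorem redStepT_iff_s4 {n : ℕ} (π π' : Equiv.Perm (Fin (n + 1))) :
    redStepT π π' ↔
      (π (Fin.last n) : ℕ) ≠ n ∧ π' = π.trans (rauzyCycle (π (Fin.last n))) := by
  rw [redStepT, forall_val_add_one_eq_iff]
  simp only [Equiv.ext_iff, Fin.ext_iff, Equiv.trans_apply, rauzyCycle_val, ne_eq,
    Nat.add_right_cancel_iff]

theorem redStepB_iff_s4 {n : ℕ} (π π' : Equiv.Perm (Fin (n + 1))) :
    redStepB π π' ↔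
      (π (Fin.last n) : ℕ) ≠ n ∧
        π' = (rauzyCycle (π.symm (Fin.last n))).symm.trans π := by
  rw [redStepB, forall_val_add_one_eq_iff]
  simp only [Equiv.ext_iff, Equiv.trans_apply, ne_eq, Nat.add_right_cancel_iff]
  refine and_congr_right fun _ => forall_congr' fun j => ?_
  set p := π.symm (Fin.last n)
  have hj := rauzyCycle_symm_val p j
  constructor
  · rintro ⟨h₁, h₂, h₃⟩
    split_ifs at hj with hle heq
    · rw [h₁ hle, Fin.ext hj]
    · rw [h₂ heq]
      exact congrArg π (Fin.ext hj.symm)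
    · exact h₃ (by omega) _ (by omega)
  · intro h
    rw [h]
    refine ⟨fun hle => ?_, fun heq => ?_, fun hlt i hi => ?_⟩ <;>
      refine congrArg π (Fin.ext ?_) <;> rw [hj]
    · rw [if_pos hle]
    · rw [if_neg (by omega), if_pos heq, Fin.val_last]
    · rw [if_neg (by omega), if_neg (by omega)]
      omega

/-! ### Rauzy moves on one-line notations -/

/-- The one-line notation of a permutation. -/
def oneLine {d : ℕ} (π : Equiv.Perm (Fin d)) : List ℕ := List.ofFn fun i => (π i : ℕ)

theorem oneLine_getD {d : ℕ} (π : Equiv.Perm (Fin d)) (i : Fin d) (a : ℕ) :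
    (oneLine π).getD i a = π i := by
  simp [oneLine]

theorem oneLine_injective {d : ℕ} : Function.Injective (oneLine (d := d)) := by
  intro π π' h
  ext i
  rw [← oneLine_getD π i 0, h, oneLine_getD]

theorem oneLine_idxOf {d : ℕ} (π : Equiv.Perm (Fin d)) (x : Fin d) :
    (oneLine π).idxOf (x : ℕ) = π.symm x := by
  have hnodup : (oneLine π).Nodup :=
    List.nodup_ofFn.2 (Fin.val_injective.comp π.injective)
  have h := hnodup.idxOf_getElem (π.symm x) (by simp [oneLine])
  simpa [oneLine] using h

/-- The top move on one-line notations of permutations of `n + 1` letters. -/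
def topList (n k : ℕ) (l : List ℕ) : List ℕ :=
  l.map fun x => bif x.ble k then x else bif x.beq n then k + 1 else x + 1

/-- The bottom move on one-line notations of permutations of `n + 1` letters. -/
def bottomList (n p : ℕ) (l : List ℕ) : List ℕ :=
  (List.range (n + 1)).map fun j =>
    l.getD (bif j.ble p then j else bif j.beq (p + 1) then n else j - 1) 0

/-- The one-line notations obtained from `l` by one Rauzy move. -/
def rauzySuccessors (n : ℕ) (l : List ℕ) : List (List ℕ) :=
  bif (l.getD n 0).beq n then []
  else [topList n (l.getD n 0) l, bottomList n (l.idxOf n) l]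

theorem topList_oneLine {n : ℕ} (π : Equiv.Perm (Fin (n + 1))) (k : Fin (n + 1)) :
    topList n k (oneLine π) = oneLine (π.trans (rauzyCycle k)) := by
  simp only [topList, oneLine, List.map_ofFn]
  congr 1
  funext i
  simp only [Function.comp_apply, Equiv.trans_apply, rauzyCycle_val, Bool.cond_eq_ite,
    Nat.ble_eq, Nat.beq_eq]

theorem bottomList_oneLine {n : ℕ} (π : Equiv.Perm (Fin (n + 1))) (p : Fin (n + 1)) :
    bottomList n p (oneLine π) = oneLine ((rauzyCycle p).symm.trans π) := by
  apply List.ext_getElem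
  · simp [bottomList, oneLine]
  · intro j hj _
    have hj' : j < n + 1 := by simpa [bottomList] using hj
    have h := oneLine_getD π ((rauzyCycle p).symm ⟨j, hj'⟩) 0
    rw [rauzyCycle_symm_val] at h
    simp only [bottomList, List.getElem_map, List.getElem_range, Bool.cond_eq_ite, Nat.ble_eq,
      Nat.beq_eq, h]
    simp only [oneLine, List.getElem_ofFn, Equiv.trans_apply]

theorem mem_rauzySuccessors {n : ℕ} (π : Equiv.Perm (Fin (n + 1))) (l : List ℕ) :
    l ∈ rauzySuccessors n (oneLine π) ↔
      ∃ π', (redStepT π π' ∨ redStepB π π') ∧ oneLine π' = l := by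
  have hk : (oneLine π).getD n 0 = π (Fin.last n) := oneLine_getD π (Fin.last n) 0
  have hp : (oneLine π).idxOf n = π.symm (Fin.last n) := oneLine_idxOf π (Fin.last n)
  simp only [redStepT_iff_s4, redStepB_iff_s4, ← and_or_left]
  rw [rauzySuccessors, hk, hp, topList_oneLine, bottomList_oneLine, Bool.cond_eq_ite]
  by_cases h : (π (Fin.last n) : ℕ) = n
  · simp [h]
  · simp [h, or_and_right, exists_or, eq_comm (a := l)]

/-! ### Exhaustive search with a search tree of visited keys -/

/-- Binary search trees of natural numbers. -/
inductive KeyTree where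
  | leaf : KeyTree
  | node : KeyTree → ℕ → KeyTree → KeyTree

namespace KeyTree

/-- Lookup along the search path of `x`. -/
def contains (x : ℕ) : KeyTree → Bool
  | leaf => false
  | node l k r => bif x.beq k then true else bif x.ble k then l.contains x else r.contains x

/-- Insertion at the end of the search path of `x`. -/
def insert (x : ℕ) : KeyTree → KeyTree
  | leaf => node leaf x leaf
  | node l k r =>
    bif x.beq k then node l k r
    else bif x.ble k then node (l.insert x) k r else node l k (r.insert x)

theorem contains_insert (x y : ℕ) (t : KeyTree) :
    (t.insert x).contains y = true ↔ y = x ∨ t.contains y = true := by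
  induction t with
  | leaf => simp [insert, contains, Bool.cond_eq_ite]
  | node l k r ihl ihr =>
    simp only [insert, Bool.cond_eq_ite, Nat.beq_eq, Nat.ble_eq]
    split_ifs with h₁ h₂ <;>
      simp only [contains, Bool.cond_eq_ite, Nat.beq_eq, Nat.ble_eq] <;>
      split_ifs <;> grind

end KeyTree

/-- Depth-first search listing everything reachable from a stack; `none` if the fuel runs out. -/
def searchReachable {α : Type*} (next : α → List α) (key : α → ℕ) :
    ℕ → List α → KeyTree → List α → Option (List α)
  | _, [], _, acc => some acc
  | 0, _ :: _, _, _ => none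
  | fuel + 1, x :: stack, t, acc =>
    bif t.contains (key x) then searchReachable next key fuel stack t acc
    else searchReachable next key fuel (next x ++ stack) (t.insert (key x)) (x :: acc)

theorem searchReachable_spec {α : Type*} {next : α → List α} {key : α → ℕ} {S : Set α}
    (hS : ∀ x ∈ S, ∀ y ∈ next x, y ∈ S) (hkey : Set.InjOn key S) {result : List α} :
    ∀ (fuel : ℕ) (stack : List α) (t : KeyTree) (acc : List α),
      (∀ x ∈ stack, x ∈ S) → (∀ x ∈ acc, x ∈ S) → acc.Nodup →
      (∀ m, t.contains m = true ↔ ∃ x ∈ acc, key x = m) →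
      (∀ x ∈ acc, ∀ y ∈ next x, y ∈ acc ∨ y ∈ stack) →
      searchReachable next key fuel stack t acc = some result →
      result.Nodup ∧ (∀ x ∈ result, x ∈ S) ∧ (∀ x ∈ acc, x ∈ result) ∧
        (∀ x ∈ stack, x ∈ result) ∧ ∀ x ∈ result, ∀ y ∈ next x, y ∈ result := by
  intro fuel
  induction fuel with
  | zero =>
    intro stack t acc hstack hacc hnodup ht hclosed h
    cases stack with
    | nil =>
      obtain rfl : acc = result := by simpa [searchReachable] using h
      exact ⟨hnodup, hacc, fun _ hx => hx, by simp, by simpa using hclosed⟩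
    | cons x stack => simp [searchReachable] at h
  | succ fuel ih =>
    intro stack t acc hstack hacc hnodup ht hclosed h
    cases stack with
    | nil =>
      obtain rfl : acc = result := by simpa [searchReachable] using h
      exact ⟨hnodup, hacc, fun _ hx => hx, by simp, by simpa using hclosed⟩
    | cons x stack =>
      obtain ⟨hxS, hstackS⟩ := List.forall_mem_cons.1 hstack
      rw [searchReachable, Bool.cond_eq_ite] at h
      split_ifs at h with hx
      · obtain ⟨y, hy, hyx⟩ := (ht _).1 hx
        obtain rfl := hkey (hacc y hy) hxS hyx
        obtain ⟨h₁, h₂, h₃, h₄, h₅⟩ := ih stack t acc hstackS hacc hnodup ht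
          (fun z hz w hw => by
            rcases hclosed z hz w hw with hw' | hw'
            · exact Or.inl hw'
            · rcases List.mem_cons.1 hw' with rfl | hw'
              · exact Or.inl hy
              · exact Or.inr hw') h
        exact ⟨h₁, h₂, h₃, List.forall_mem_cons.2 ⟨h₃ y hy, h₄⟩, h₅⟩
      · have hxacc : x ∉ acc := fun hmem => hx ((ht _).2 ⟨x, hmem, rfl⟩)
        obtain ⟨h₁, h₂, h₃, h₄, h₅⟩ := ih (next x ++ stack) (t.insert (key x)) (x :: acc)
          (fun y hy => (List.mem_append.1 hy).elim (hS x hxS y) (hstackS y))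
          (List.forall_mem_cons.2 ⟨hxS, hacc⟩) (List.nodup_cons.2 ⟨hxacc, hnodup⟩)
          (fun m => by
            simp only [KeyTree.contains_insert, ht, List.exists_mem_cons_iff, eq_comm (a := m)])
          (fun z hz w hw => by
            rcases List.mem_cons.1 hz with rfl | hz
            · exact Or.inr (List.mem_append_left _ hw)
            · rcases hclosed z hz w hw with hw' | hw'
              · exact Or.inl (List.mem_cons_of_mem _ hw')
              · rcases List.mem_cons.1 hw' with rfl | hw'
                · exact Or.inl List.mem_cons_self
                · exact Or.inr (List.mem_append_right _ hw')) h
        obtain ⟨hxr, haccr⟩ := List.forall_mem_cons.1 h₃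
        exact ⟨h₁, h₂, haccr, List.forall_mem_cons.2
          ⟨hxr, fun y hy => h₄ y (List.mem_append_right _ hy)⟩, h₅⟩

/-! ### Counting the Rauzy class -/

/-- The number with base-`b` digits `l`, least significant first. -/
def digitKey (b : ℕ) (l : List ℕ) : ℕ := l.foldr (fun x m => x + b * m) 0

theorem digitKey_injOn_oneLine {d : ℕ} (hd : 1 < d) :
    Set.InjOn (digitKey d) (Set.range (oneLine (d := d))) := by
  have hkey : ∀ l, digitKey d l = Nat.ofDigits d l := by
    intro l
    simp [digitKey, Nat.ofDigits_eq_foldr]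
  have hlt : ∀ π : Equiv.Perm (Fin d), ∀ x ∈ oneLine π, x < d := by
    intro π x hx
    obtain ⟨i, rfl⟩ := (List.mem_ofFn' _ _).1 hx
    exact (π i).isLt
  rintro _ ⟨π, rfl⟩ _ ⟨π', rfl⟩ h
  rw [hkey, hkey] at h
  exact Nat.ofDigits_inj_of_len_eq hd (by simp [oneLine]) (hlt π) (hlt π') h

theorem redRauzyClass_finite_and_ncard_of_search {n : ℕ} (hn : 0 < n)
    (σ : Equiv.Perm (Fin (n + 1))) {fuel : ℕ} {result : List (List ℕ)}
    (h : searchReachable (rauzySuccessors n) (digitKey (n + 1)) fuel [oneLine σ] .leaf [] =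
      some result) :
    (redRauzyClass σ).Finite ∧ (redRauzyClass σ).ncard = result.length := by
  have hclass : ∀ l ∈ oneLine '' redRauzyClass σ, ∀ l' ∈ rauzySuccessors n l,
      l' ∈ oneLine '' redRauzyClass σ := by
    rintro _ ⟨π, hπ, rfl⟩ l' hl'
    obtain ⟨π', hstep, rfl⟩ := (mem_rauzySuccessors π l').1 hl'
    exact ⟨π', Relation.ReflTransGen.tail hπ hstep, rfl⟩
  obtain ⟨hnodup, hsub, -, hstart, hclosed⟩ := searchReachable_spec hclass
    ((digitKey_injOn_oneLine (by omega)).mono (Set.image_subset_range _ _))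
    fuel [oneLine σ] .leaf []
    (by simpa using ⟨σ, Relation.ReflTransGen.refl, rfl⟩) (by simp) List.nodup_nil
    (by simp [KeyTree.contains]) (by simp) h
  have hreach : ∀ π ∈ redRauzyClass σ, oneLine π ∈ result := by
    intro π hπ
    induction hπ with
    | refl => exact hstart _ List.mem_cons_self
    | tail _ hstep ih =>
      exact hclosed _ ih _ ((mem_rauzySuccessors _ _).2 ⟨_, hstep, rfl⟩)
  have himage : oneLine '' redRauzyClass σ = (result.toFinset : Set (List ℕ)) := by
    ext l
    rw [Finset.mem_coe, List.mem_toFinset]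
    exact ⟨by rintro ⟨π, hπ, rfl⟩; exact hreach π hπ, hsub l⟩
  refine ⟨Set.Finite.of_finite_image ?_ oneLine_injective.injOn, ?_⟩
  · exact himage ▸ Finset.finite_toSet _
  · rw [← Set.ncard_image_of_injective _ oneLine_injective, himage, Set.ncard_coe_finset,
      List.toFinset_card_of_nodup hnodup]

theorem search_example_length :
    (searchReachable (rauzySuccessors 8) (digitKey 9) 2511 [[8, 0, 3, 2, 1, 4, 7, 6, 5]]
      .leaf []).map List.length = some 1255 := by
  decide +kernel

/-- The permutation of `{1,…,9}` with one-line notation `(9, 1, 4, 3, 2, 5, 8, 7, 6)`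
(encoded 0-based on `Fin 9` as `(8, 0, 3, 2, 1, 4, 7, 6, 5)`) has a reduced Rauzy class
that is finite of cardinality `1255`. -/
theorem redRauzyClass_example_card (σ : Equiv.Perm (Fin 9))
    (hσ : σ 0 = 8 ∧ σ 1 = 0 ∧ σ 2 = 3 ∧ σ 3 = 2 ∧ σ 4 = 1 ∧ σ 5 = 4 ∧
      σ 6 = 7 ∧ σ 7 = 6 ∧ σ 8 = 5) :
    (redRauzyClass σ).Finite ∧ (redRauzyClass σ).ncard = 1255 := by
  obtain ⟨h₀, h₁, h₂, h₃, h₄, h₅, h₆, h₇, h₈⟩ := hσ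
  have hline : oneLine σ = [8, 0, 3, 2, 1, 4, 7, 6, 5] := by
    simp [oneLine, List.ofFn_succ, h₀, h₁, h₂, h₃, h₄, h₅, h₆, h₇, h₈]
  obtain ⟨result, hresult, hlength⟩ := Option.map_eq_some_iff.1 search_example_length
  rw [← hline] at hresult
  rw [← hlength]
  exact redRauzyClass_finite_and_ncard_of_search (by norm_num) σ hresult
end
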